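/- Let y : (−3,3) → ℝ be a smooth function, positive on (−1,1), that is odd about r = −1 (i.e. y(−1−t) = −y(−1+t) for small t) and odd about r = 1 (i.e. y(1+t) = −y(1−t) for small t) and satisfies y'(−1) = 1 and y'(1) = −1. Set σ = y². Then there exists a function l : [−1,1] → ℝ which is the restriction of a smooth function on (−3,3) that is even about r = −1 and even about r = 1, and which satisfies: l''(r) = (l(r)³ − l(r))/σ(r) for all r ∈ (−1,1); l(−1) = −1 and l(1) = 1; l'(r) > 0 for all r ∈ (−1,1); and l''(−1) > 0 and l''(1) < 0. -/

import Mathlib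

namespace Stmt15

open Set Filter Topology


lemma clamp_lip (A B x y : ℝ) : |max A (min B x) - max A (min B y)| ≤ |x - y| := by
  have h1 : |max A (min B x) - max A (min B y)| ≤ |min B x - min B y| := by
    simpa [max_comm] using abs_max_sub_max_le_abs (min B x) (min B y) A
  have h2 : |min B x - min B y| ≤ |x - y| := by
    simpa [min_comm] using abs_min_sub_min_le_max x B y B
  exact h1.trans h2

/-- Global solvability of the initial value problem `l'' = F r l` with bounded Lipschitz `F`. -/
lemma ivp (F : ℝ → ℝ → ℝ) (C K : ℝ) (hC : 0 ≤ C)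
    (hFc : ∀ x, Continuous fun r => F r x) (hFb : ∀ r x, |F r x| ≤ C)
    (hFl : ∀ r x x', |F r x - F r x'| ≤ K * |x - x'|)
    (r0 : ℝ) (hr0 : r0 ∈ Icc (-1 : ℝ) 1) (p q : ℝ) :
    ∃ l v : ℝ → ℝ, l r0 = p ∧ v r0 = q ∧
      ∀ r ∈ Icc (-1 : ℝ) 1, HasDerivAt l (v r) r ∧ HasDerivAt v (F r (l r)) r := by
  obtain ⟨h1, h2⟩ := hr0
  set M : ℝ := |q| + 4 * C with hM
  have hM0 : 0 ≤ M := by positivity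
  let f : ℝ → ℝ × ℝ → ℝ × ℝ := fun t z => (max (-M) (min M z.2), F t z.1)
  have hr0' : r0 ∈ Icc (-2 : ℝ) 2 := ⟨by linarith, by linarith⟩
  let L : NNReal := Real.toNNReal (max M C)
  have hL : (L : ℝ) = max M C := Real.coe_toNNReal _ (le_max_of_le_left hM0)
  have hpl : IsPicardLindelof f (⟨r0, hr0'⟩ : Icc (-2 : ℝ) 2) (p, q) (L * 4) 0 L
      (Real.toNNReal (max 1 K)) := by
    refine ⟨?_, ?_, ?_, ?_⟩
    · intro t _
      apply LipschitzOnWith.of_dist_le_mul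
      intro z _ z' _
      rw [Real.coe_toNNReal _ (by positivity)]
      simp only [f, Prod.dist_eq, Real.dist_eq]
      have e1 : |z.1 - z'.1| ≤ max |z.1 - z'.1| |z.2 - z'.2| := le_max_left _ _
      have e2 : |z.2 - z'.2| ≤ max |z.1 - z'.1| |z.2 - z'.2| := le_max_right _ _
      have e3 : (1 : ℝ) ≤ max 1 K := le_max_left _ _
      have e4 : K ≤ max 1 K := le_max_right _ _
      have e0 := abs_nonneg (z.1 - z'.1)
      apply max_le
      · refine (clamp_lip _ _ _ _).trans (e2.trans ?_)
        exact le_mul_of_one_le_left (e0.trans e1) e3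
      · refine (hFl _ _ _).trans ?_
        exact mul_le_mul e4 e1 e0 (by positivity)
    · intro z _
      exact (continuous_const.prodMk (hFc _)).continuousOn
    · intro t _ z _
      simp only [f, Prod.norm_def, Real.norm_eq_abs, hL]
      apply max_le_max
      · rw [abs_le]
        exact ⟨le_max_left _ _, max_le (by linarith) (min_le_left _ _)⟩
      · exact hFb _ _
    · simp only [NNReal.coe_mul, NNReal.coe_zero, sub_zero]
      apply mul_le_mul_of_nonneg_left _ L.2
      push_cast
      apply max_le <;> linarith
  obtain ⟨z, hz0, hz⟩ := hpl.exists_eq_forall_mem_Icc_hasDerivWithinAt₀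
  have hz' : ∀ t ∈ Ioo (-2 : ℝ) 2, HasDerivAt z (f t (z t)) t := fun t ht =>
    (hz t (Ioo_subset_Icc_self ht)).hasDerivAt (Icc_mem_nhds ht.1 ht.2)
  have hv : ∀ t ∈ Ioo (-2 : ℝ) 2, HasDerivAt (fun r => (z r).2) (F t (z t).1) t := by
    intro t ht
    exact (hasFDerivAt_snd.comp_hasDerivAt t (hz' t ht))
  have hl : ∀ t ∈ Ioo (-2 : ℝ) 2,
      HasDerivAt (fun r => (z r).1) (max (-M) (min M (z t).2)) t := by
    intro t ht
    exact (hasFDerivAt_fst.comp_hasDerivAt t (hz' t ht))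
  have hzr : z r0 = (p, q) := hz0
  have hvb : ∀ t ∈ Icc (-1 : ℝ) 1, |(z t).2| ≤ M := by
    intro t ht
    have := (convex_Icc (-1 : ℝ) 1).norm_image_sub_le_of_norm_hasDerivWithin_le
      (f := fun r => (z r).2) (f' := fun t => F t (z t).1) (C := C)
      (fun x hx => (hv x ⟨by linarith [hx.1], by linarith [hx.2]⟩).hasDerivWithinAt)
      (fun x _ => hFb _ _) (⟨h1, h2⟩ : r0 ∈ Icc (-1 : ℝ) 1) ht
    simp only [hzr, Real.norm_eq_abs] at this
    have h3 : |t - r0| ≤ 2 := by rw [abs_le]; constructor <;> linarith [ht.1, ht.2]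
    have h4 : C * |t - r0| ≤ C * 2 := mul_le_mul_of_nonneg_left h3 hC
    have h5 : |(z t).2| ≤ |(z t).2 - q| + |q| := by
      simpa using abs_add_le ((z t).2 - q) q
    linarith
  refine ⟨fun r => (z r).1, fun r => (z r).2, by simp [hzr], by simp [hzr], ?_⟩
  intro r hr
  have hr' : r ∈ Ioo (-2 : ℝ) 2 := ⟨by linarith [hr.1], by linarith [hr.2]⟩
  refine ⟨?_, hv r hr'⟩
  have := hl r hr'
  have hb := abs_le.1 (hvb r hr)
  rwa [min_eq_right hb.2, max_eq_right hb.1] at this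

/-- Continuous dependence on initial data (energy form). -/
lemma gron (K : ℝ) (hK : 0 ≤ K) (a b r0 : ℝ) (hr0 : r0 ∈ Icc a b)
    (l v l' v' G G' : ℝ → ℝ)
    (h : ∀ r ∈ Icc a b, HasDerivAt l (v r) r ∧ HasDerivAt v (G r) r)
    (h' : ∀ r ∈ Icc a b, HasDerivAt l' (v' r) r ∧ HasDerivAt v' (G' r) r)
    (hG : ∀ r ∈ Icc a b, |G r - G' r| ≤ K * |l r - l' r|) :
    ∀ r ∈ Icc a b, (l r - l' r) ^ 2 + (v r - v' r) ^ 2 ≤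
      ((l r0 - l' r0) ^ 2 + (v r0 - v' r0) ^ 2) * Real.exp ((1 + K) * |r - r0|) := by
  set D : ℝ → ℝ := fun r => (l r - l' r) ^ 2 + (v r - v' r) ^ 2 with hD
  set D' : ℝ → ℝ := fun r => 2 * (l r - l' r) * (v r - v' r) +
    2 * (v r - v' r) * (G r - G' r) with hD'
  have hd : ∀ r ∈ Icc a b, HasDerivAt D (D' r) r := by
    intro r hr
    have e1 := (((h r hr).1.sub (h' r hr).1).pow 2).add (((h r hr).2.sub (h' r hr).2).pow 2)
    refine HasDerivAt.congr_deriv (f := D) e1 ?_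
    simp [hD']
  have hb : ∀ r ∈ Icc a b, |D' r| ≤ (1 + K) * D r := by
    intro r hr
    have e := hG r hr
    have e1 : |D' r| ≤ 2 * |l r - l' r| * |v r - v' r| +
        2 * |v r - v' r| * |G r - G' r| := by
      refine (abs_add_le _ _).trans (le_of_eq ?_)
      simp [abs_mul]
    have e2 : |v r - v' r| * |G r - G' r| ≤ |v r - v' r| * (K * |l r - l' r|) :=
      mul_le_mul_of_nonneg_left e (abs_nonneg _)
    have e3 : D r = |l r - l' r| ^ 2 + |v r - v' r| ^ 2 := by simp [hD, sq_abs]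
    rw [e3]
    nlinarith [mul_nonneg (by linarith : (0:ℝ) ≤ 1 + K) (sq_nonneg (|l r - l' r| - |v r - v' r|))]
  intro r hr
  rcases le_total r0 r with hrr | hrr
  · have hsub : Icc r0 r ⊆ Icc a b := Icc_subset_Icc hr0.1 hr.2
    have hder : ∀ x ∈ Icc a b, HasDerivAt (fun x => D x * Real.exp (-((1 + K) * x)))
        (D' x * Real.exp (-((1 + K) * x)) +
          D x * (Real.exp (-((1 + K) * x)) * (-((1 + K) * 1)))) x := fun x hx =>
      (hd x hx).mul (((hasDerivAt_id x).const_mul (1 + K)).neg.exp)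
    have hanti : AntitoneOn (fun x => D x * Real.exp (-((1 + K) * x))) (Icc r0 r) := by
      apply antitoneOn_of_deriv_nonpos (convex_Icc _ _)
      · exact fun x hx => (hder x (hsub hx)).continuousAt.continuousWithinAt
      · exact fun x hx => (hder x (hsub (interior_subset hx))).differentiableAt.differentiableWithinAt
      · intro x hx
        have hx' := hsub (interior_subset hx)
        rw [(hder x hx').deriv]
        have e1 := (abs_le.1 (hb x hx')).2
        have e2 := Real.exp_pos (-((1 + K) * x))
        nlinarith
    have := hanti (left_mem_Icc.2 hrr) (right_mem_Icc.2 hrr) hrr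
    simp only at this
    rw [abs_of_nonneg (by linarith)]
    have e4 : Real.exp ((1 + K) * (r - r0)) =
        Real.exp (-((1 + K) * r0)) * Real.exp ((1 + K) * r) := by
      rw [← Real.exp_add]; congr 1; ring
    have e5 : Real.exp (-((1 + K) * r)) * Real.exp ((1 + K) * r) = 1 := by
      rw [← Real.exp_add]; simp
    calc D r = (D r * Real.exp (-((1 + K) * r))) * Real.exp ((1 + K) * r) := by
          rw [mul_assoc, e5, mul_one]
      _ ≤ (D r0 * Real.exp (-((1 + K) * r0))) * Real.exp ((1 + K) * r) :=
          mul_le_mul_of_nonneg_right this (Real.exp_pos _).le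
      _ = _ := by rw [e4]; ring
  · have hsub : Icc r r0 ⊆ Icc a b := Icc_subset_Icc hr.1 hr0.2
    have hder : ∀ x ∈ Icc a b, HasDerivAt (fun x => D x * Real.exp (((1 + K) * x)))
        (D' x * Real.exp (((1 + K) * x)) +
          D x * (Real.exp (((1 + K) * x)) * (((1 + K) * 1)))) x := fun x hx =>
      (hd x hx).mul (((hasDerivAt_id x).const_mul (1 + K)).exp)
    have hmono : MonotoneOn (fun x => D x * Real.exp (((1 + K) * x))) (Icc r r0) := by
      apply monotoneOn_of_deriv_nonneg (convex_Icc _ _)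
      · exact fun x hx => (hder x (hsub hx)).continuousAt.continuousWithinAt
      · exact fun x hx => (hder x (hsub (interior_subset hx))).differentiableAt.differentiableWithinAt
      · intro x hx
        have hx' := hsub (interior_subset hx)
        rw [(hder x hx').deriv]
        have e1 := (abs_le.1 (hb x hx')).1
        have e2 := Real.exp_pos (((1 + K) * x))
        nlinarith
    have := hmono (left_mem_Icc.2 hrr) (right_mem_Icc.2 hrr) hrr
    simp only at this
    rw [abs_of_nonpos (by linarith)]
    have e4 : Real.exp ((1 + K) * -(r - r0)) =
        Real.exp (((1 + K) * r0)) * Real.exp (-((1 + K) * r)) := by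
      rw [← Real.exp_add]; congr 1; ring
    have e5 : Real.exp (((1 + K) * r)) * Real.exp (-((1 + K) * r)) = 1 := by
      rw [← Real.exp_add]; simp
    calc D r = (D r * Real.exp (((1 + K) * r))) * Real.exp (-((1 + K) * r)) := by
          rw [mul_assoc, e5, mul_one]
      _ ≤ (D r0 * Real.exp (((1 + K) * r0))) * Real.exp (-((1 + K) * r)) :=
          mul_le_mul_of_nonneg_right this (Real.exp_pos _).le
      _ = _ := by rw [e4]; ring

/-- Second derivative test at a local maximum. -/
lemma locmax (w w1 : ℝ → ℝ) (w2 r0 : ℝ) (h1 : ∀ᶠ r in 𝓝 r0, HasDerivAt w (w1 r) r)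
    (h2 : HasDerivAt w1 w2 r0) (hm : IsLocalMax w r0) : w1 r0 = 0 ∧ w2 ≤ 0 := by
  have hd0 : HasDerivAt w (w1 r0) r0 := h1.self_of_nhds
  have h0 : w1 r0 = 0 := hm.hasDerivAt_eq_zero hd0
  refine ⟨h0, ?_⟩
  by_contra! hpos
  have heq : deriv w =ᶠ[𝓝 r0] w1 := h1.mono fun r hr => hr.deriv
  have hdd : deriv (deriv w) r0 = w2 := by rw [heq.deriv_eq, h2.deriv]
  have hmin : IsLocalMin w r0 := isLocalMin_of_deriv_deriv_pos (by rw [hdd]; exact hpos)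
    (by rw [hd0.deriv, h0]) hd0.continuousAt
  have hc : w =ᶠ[𝓝 r0] fun _ => w r0 := by
    filter_upwards [hm, hmin] with x hx hx' using le_antisymm hx hx'
  have hc' : deriv w =ᶠ[𝓝 r0] fun _ => 0 := by
    have := hc.deriv
    simpa using this
  have : deriv (deriv w) r0 = 0 := by rw [hc'.deriv_eq]; simp
  linarith


/-- The cubic nonlinearity. -/
def fz (x : ℝ) : ℝ := x ^ 3 - x

lemma fz_neg (x : ℝ) : fz (-x) = - fz x := by unfold fz; ring

lemma fz_abs (x : ℝ) (h1 : -1 ≤ x) (h2 : x ≤ 1) : |fz x| ≤ 1 := by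
  unfold fz; rw [abs_le]; constructor <;> nlinarith [sq_nonneg x, mul_nonneg (by linarith : 0 ≤ 1 - x) (by linarith : 0 ≤ 1 + x), sq_nonneg (x - 1), sq_nonneg (x + 1)]

lemma fz_lip (x y : ℝ) (h1 : -1 ≤ x) (h2 : x ≤ 1) (h3 : -1 ≤ y) (h4 : y ≤ 1) :
    |fz x - fz y| ≤ 2 * |x - y| := by
  have e : fz x - fz y = (x ^ 2 + x * y + y ^ 2 - 1) * (x - y) := by unfold fz; ring
  rw [e, abs_mul]
  apply mul_le_mul_of_nonneg_right _ (abs_nonneg _)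
  rw [abs_le]
  constructor <;> nlinarith [sq_nonneg (x + y), sq_nonneg (x - y), sq_nonneg x, sq_nonneg y]

lemma fz_cont : Continuous fz := by unfold fz; fun_prop

/-- Supersolutions of `l'' = fz l / σ` on `(-1,1)`, in the sense of touching from above. -/
def IsSuper (σ β : ℝ → ℝ) : Prop :=
  ∀ r0 ∈ Ioo (-1 : ℝ) 1, ∃ (w w1 : ℝ → ℝ) (w2 : ℝ),
    (∀ᶠ r in 𝓝 r0, HasDerivAt w (w1 r) r) ∧ HasDerivAt w1 w2 r0 ∧ w r0 = β r0 ∧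
    (∀ᶠ r in 𝓝 r0, β r ≤ w r) ∧ w2 ≤ fz (β r0) / σ r0

/-- Solutions of `l'' = fz l / σ` on a set, with `v = l'`. -/
def SolOn (σ : ℝ → ℝ) (s : Set ℝ) (l v : ℝ → ℝ) : Prop :=
  ∀ r ∈ s, HasDerivAt l (v r) r ∧ HasDerivAt v (fz (l r) / σ r) r

lemma maxpr (σ β : ℝ → ℝ) (hβ : IsSuper σ β) (a b : ℝ) (ha : -1 < a) (hab : a < b) (hb : b < 1)
    (hc : ContinuousOn β (Icc a b)) (l v G : ℝ → ℝ)
    (h : ∀ r ∈ Icc a b, HasDerivAt l (v r) r ∧ HasDerivAt v (G r) r)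
    (hla : l a ≤ β a) (hlb : l b ≤ β b)
    (hG : ∀ r ∈ Icc a b, β r < l r → fz (β r) / σ r < G r) :
    ∀ r ∈ Icc a b, l r ≤ β r := by
  have hlc : ContinuousOn l (Icc a b) := fun r hr => (h r hr).1.continuousAt.continuousWithinAt
  obtain ⟨r0, hr0, hmax⟩ := isCompact_Icc.exists_isMaxOn (nonempty_Icc.2 hab.le) (hlc.sub hc)
  by_contra! hcon
  obtain ⟨r1, hr1, hr1'⟩ := hcon
  have hpos : β r0 < l r0 := by
    have : l r1 - β r1 ≤ l r0 - β r0 := hmax hr1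
    linarith
  have ha' : a < r0 := lt_of_le_of_ne hr0.1 (by rintro rfl; linarith)
  have hb' : r0 < b := lt_of_le_of_ne hr0.2 (by rintro rfl; linarith)
  have hn : Icc a b ∈ 𝓝 r0 := Icc_mem_nhds ha' hb'
  obtain ⟨w, w1, w2, hw, hw1, hwe, hwb, hw2⟩ := hβ r0 ⟨by linarith, by linarith⟩
  have hloc : IsLocalMax (fun r => l r - w r) r0 := by
    filter_upwards [hwb, hn] with r hr hrn
    have : l r - β r ≤ l r0 - β r0 := hmax hrn
    rw [hwe]; linarith
  have := (locmax (fun r => l r - w r) (fun r => v r - w1 r) (G r0 - w2) r0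
    (by filter_upwards [hw, hn] with r hr hrn using (h r hrn).1.sub hr)
    ((h r0 hr0).2.sub hw1) hloc).2
  have := hG r0 hr0 hpos
  linarith

lemma sig_bound (σ : ℝ → ℝ) (hσ : ContinuousOn σ (Ioo (-1) 1)) (hσp : ∀ r ∈ Ioo (-1 : ℝ) 1, 0 < σ r)
    (a b : ℝ) (ha : -1 < a) (hb : b < 1) :
    ∃ S : ℝ, 0 ≤ S ∧ ∀ r ∈ Icc a b, (σ r)⁻¹ ≤ S := by
  have hsub : Icc a b ⊆ Ioo (-1 : ℝ) 1 := fun r hr => ⟨by linarith [hr.1], by linarith [hr.2]⟩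
  have hc : ContinuousOn (fun r => (σ r)⁻¹) (Icc a b) :=
    (hσ.mono hsub).inv₀ fun r hr => (hσp r (hsub hr)).ne'
  obtain ⟨S, hS⟩ := isCompact_Icc.exists_bound_of_continuousOn hc
  refine ⟨max S 0, le_max_right _ _, fun r hr => ?_⟩
  exact (le_abs_self _).trans ((hS r hr).trans (le_max_left _ _))

lemma shoot (σ : ℝ → ℝ) (hσ : ContinuousOn σ (Ioo (-1) 1)) (hσp : ∀ r ∈ Ioo (-1 : ℝ) 1, 0 < σ r)
    (α β : ℝ → ℝ) (hα : ContinuousOn α (Ioo (-1) 1)) (hβ : ContinuousOn β (Ioo (-1) 1))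
    (hα1 : ∀ r ∈ Ioo (-1 : ℝ) 1, -1 ≤ α r) (hαβ : ∀ r ∈ Ioo (-1 : ℝ) 1, α r ≤ β r)
    (hβ1 : ∀ r ∈ Ioo (-1 : ℝ) 1, β r ≤ 1)
    (hsb : IsSuper σ (fun r => - α r)) (hsp : IsSuper σ β)
    (a b : ℝ) (ha : -1 < a) (hab : a < b) (hb : b < 1) :
    ∃ l v, SolOn σ (Icc a b) l v ∧ ∀ r ∈ Icc a b, α r ≤ l r ∧ l r ≤ β r := by
  have hsub : Icc a b ⊆ Ioo (-1 : ℝ) 1 := fun r hr => ⟨by linarith [hr.1], by linarith [hr.2]⟩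
  obtain ⟨S, hS0, hS⟩ := sig_bound σ hσ hσp a b ha hb
  let pr : ℝ → ℝ := fun r => max a (min b r)
  have hprm : ∀ r, pr r ∈ Icc a b := fun r =>
    ⟨le_max_left _ _, max_le hab.le (min_le_left _ _)⟩
  have hpri : ∀ r ∈ Icc a b, pr r = r := fun r hr => by
    simp only [pr]; rw [min_eq_right hr.2, max_eq_right hr.1]
  have hprc : Continuous pr := by fun_prop
  have hcomp : ∀ g : ℝ → ℝ, ContinuousOn g (Ioo (-1) 1) → Continuous fun r => g (pr r) := by
    intro g hg
    exact hg.comp_continuous hprc fun r => hsub (hprm r)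
  let tr : ℝ → ℝ → ℝ := fun r x => max (α (pr r)) (min (β (pr r)) x)
  have htr1 : ∀ r x, -1 ≤ tr r x := fun r x => (hα1 _ (hsub (hprm r))).trans (le_max_left _ _)
  have htr2 : ∀ r x, tr r x ≤ 1 := fun r x =>
    max_le ((hαβ _ (hsub (hprm r))).trans (hβ1 _ (hsub (hprm r))))
      ((min_le_left _ _).trans (hβ1 _ (hsub (hprm r))))
  let F : ℝ → ℝ → ℝ := fun r x => fz (tr r x) * (σ (pr r))⁻¹ + (max (-2) (min 2 x) - tr r x)
  have hFc : ∀ x, Continuous fun r => F r x := by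
    intro x
    have h1 : Continuous fun r => tr r x :=
      (hcomp α hα).max ((hcomp β hβ).min continuous_const)
    have h2 : Continuous fun r => (σ (pr r))⁻¹ :=
      (hcomp σ hσ).inv₀ fun r => (hσp _ (hsub (hprm r))).ne'
    exact ((fz_cont.comp h1).mul h2).add (continuous_const.sub h1)
  have hi0 : ∀ r, 0 ≤ (σ (pr r))⁻¹ := fun r => (inv_pos.2 (hσp _ (hsub (hprm r)))).le
  have hFb : ∀ r x, |F r x| ≤ S + 3 := by
    intro r x
    have h1 := htr1 r x
    have h2 := htr2 r x
    have e1 : |fz (tr r x) * (σ (pr r))⁻¹| ≤ 1 * S := by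
      rw [abs_mul, abs_of_nonneg (hi0 r)]
      exact mul_le_mul (fz_abs _ h1 h2) (hS _ (hprm r)) (hi0 r) zero_le_one
    have e2 : |max (-2) (min 2 x) - tr r x| ≤ 3 := by
      have e3 : max (-2) (min 2 x) ≤ 2 := max_le (by norm_num) (min_le_left _ _)
      have e4 : -2 ≤ max (-2) (min 2 x) := le_max_left _ _
      rw [abs_le]; constructor <;> linarith
    exact (abs_add_le _ _).trans (by linarith)
  have htrl : ∀ r x x', |tr r x - tr r x'| ≤ |x - x'| := fun r x x' => clamp_lip _ _ _ _
  have hFl : ∀ r x x', |F r x - F r x'| ≤ (2 * S + 2) * |x - x'| := by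
    intro r x x'
    have e0 : F r x - F r x' = (fz (tr r x) - fz (tr r x')) * (σ (pr r))⁻¹ +
      ((max (-2) (min 2 x) - max (-2) (min 2 x')) - (tr r x - tr r x')) := by
      simp only [F]; ring
    have e1 : |(fz (tr r x) - fz (tr r x')) * (σ (pr r))⁻¹| ≤ (2 * |x - x'|) * S := by
      rw [abs_mul, abs_of_nonneg (hi0 r)]
      refine mul_le_mul ?_ (hS _ (hprm r)) (hi0 r) (by positivity)
      have := fz_lip _ _ (htr1 r x) (htr2 r x) (htr1 r x') (htr2 r x')
      have := htrl r x x'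
      linarith
    have e2 := clamp_lip (-2) 2 x x'
    have e3 := htrl r x x'
    have e4 := abs_sub (max (-2) (min 2 x) - max (-2) (min 2 x')) (tr r x - tr r x')
    rw [e0]
    refine (abs_add_le _ _).trans ?_
    linarith
  have ham : a ∈ Icc (-1 : ℝ) 1 := ⟨by linarith, by linarith⟩
  have hivp := fun m => ivp F (S + 3) (2 * S + 2) (by linarith) hFc hFb hFl a ham (α a) m
  choose L V hL0 hV0 hLV using hivp
  have hsub' : Icc a b ⊆ Icc (-1 : ℝ) 1 := fun r hr => Ioo_subset_Icc_self (hsub hr)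
  have hbm : b ∈ Icc a b := right_mem_Icc.2 hab.le
  have ham' : a ∈ Icc a b := left_mem_Icc.2 hab.le
  have hcont : Continuous fun m => L m b := by
    rw [continuous_iff_continuousAt]
    intro m
    have hest : ∀ m', (L m' b - L m b) ^ 2 ≤ (m' - m) ^ 2 *
        Real.exp ((1 + (2 * S + 2)) * |b - a|) := by
      intro m'
      have := gron (2 * S + 2) (by linarith) a b a ham' (L m') (V m') (L m) (V m) _ _
        (fun r hr => hLV m' r (hsub' hr)) (fun r hr => hLV m r (hsub' hr))
        (fun r hr => hFl _ _ _) b hbm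
      rw [hL0, hL0, hV0, hV0] at this
      nlinarith [sq_nonneg (V m' b - V m b)]
    have ht : Tendsto (fun m' => (m' - m) ^ 2 *
        Real.exp ((1 + (2 * S + 2)) * |b - a|)) (𝓝 m) (𝓝 0) := by
      have : Continuous (fun m' => (m' - m) ^ 2 *
        Real.exp ((1 + (2 * S + 2)) * |b - a|)) := by fun_prop
      simpa using this.tendsto m
    have h1 : Tendsto (fun m' => (L m' b - L m b) ^ 2) (𝓝 m) (𝓝 0) :=
      squeeze_zero (fun _ => sq_nonneg _) hest ht
    have h2 : Tendsto (fun m' => |L m' b - L m b|) (𝓝 m) (𝓝 0) := by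
      have := (Real.continuous_sqrt.tendsto 0).comp h1
      simpa [Function.comp_def, Real.sqrt_sq_eq_abs] using this
    exact tendsto_iff_dist_tendsto_zero.2 (by simpa [Real.dist_eq] using h2)
  have hgrow : ∀ m, |L m b - α a - m * (b - a)| ≤ (S + 3) * 2 * (b - a) := by
    intro m
    have hVb : ∀ r ∈ Icc a b, |V m r - m| ≤ (S + 3) * 2 := by
      intro r hr
      have := (convex_Icc a b).norm_image_sub_le_of_norm_hasDerivWithin_le
        (f := V m) (C := S + 3)
        (fun x hx => (hLV m x (hsub' hx)).2.hasDerivWithinAt)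
        (fun x _ => hFb _ _) ham' hr
      rw [hV0, Real.norm_eq_abs, Real.norm_eq_abs] at this
      refine this.trans ?_
      apply mul_le_mul_of_nonneg_left _ (by linarith)
      rw [abs_le]; constructor <;> linarith [hr.1, hr.2]
    have := (convex_Icc a b).norm_image_sub_le_of_norm_hasDerivWithin_le
        (f := fun r => L m r - m * r) (f' := fun r => V m r - m) (C := (S + 3) * 2)
        (fun x hx => ((hLV m x (hsub' hx)).1.sub
          (by simpa using (hasDerivAt_id x).const_mul m)).hasDerivWithinAt)
        (fun x hx => hVb x hx) ham' hbm
    rw [Real.norm_eq_abs, Real.norm_eq_abs, hL0, abs_of_nonneg (by linarith : 0 ≤ b - a)] at this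
    convert this using 2
    ring
  have hba : 0 < b - a := by linarith
  obtain ⟨m, hm⟩ : ∃ m, L m b = α b := by
    set T : ℝ := (S + 3) * 2 * (b - a) + |α b - α a| with hT
    have hT0 : 0 ≤ T := by positivity
    have k1 := abs_le.1 (hgrow (T / (b - a)))
    have k2 := abs_le.1 (hgrow (-(T / (b - a))))
    have k3 : T / (b - a) * (b - a) = T := by field_simp
    have k4 : -(T / (b - a)) * (b - a) = -T := by field_simp
    rw [k3] at k1
    rw [k4] at k2
    have k5 := abs_le.1 (le_refl |α b - α a|)
    have hle : -(T / (b - a)) ≤ T / (b - a) := by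
      have : 0 ≤ T / (b - a) := by positivity
      linarith
    have := intermediate_value_Icc hle hcont.continuousOn
    obtain ⟨m, _, hm⟩ := this (⟨by linarith [k2.2, k5.1], by linarith [k1.1, k5.2]⟩ :
      α b ∈ Icc (L (-(T / (b - a))) b) (L (T / (b - a)) b))
    exact ⟨m, hm⟩
  have hLm : ∀ r ∈ Icc a b, HasDerivAt (L m) (V m r) r ∧ HasDerivAt (V m) (F r (L m r)) r :=
    fun r hr => hLV m r (hsub' hr)
  have hup : ∀ r ∈ Icc a b, L m r ≤ β r := by
    apply maxpr σ β hsp a b ha hab hb (hβ.mono hsub) (L m) (V m) _ hLm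
    · rw [hL0]; exact hαβ _ (hsub ham')
    · rw [hm]; exact hαβ _ (hsub hbm)
    · intro r hr hlt
      have et : tr r (L m r) = β r := by
        simp only [tr, hpri r hr]
        rw [min_eq_left hlt.le, max_eq_right (hαβ r (hsub hr))]
      simp only [F, et, hpri r hr, div_eq_mul_inv]
      have : β r < max (-2) (min 2 (L m r)) :=
        lt_max_of_lt_right (lt_min (by linarith [hβ1 r (hsub hr)]) hlt)
      linarith
  have hlo : ∀ r ∈ Icc a b, -L m r ≤ -α r := by
    apply maxpr σ (fun r => -α r) hsb a b ha hab hb (hα.neg.mono hsub) (fun r => -L m r)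
      (fun r => - V m r) _ (fun r hr => ⟨(hLm r hr).1.neg, (hLm r hr).2.neg⟩)
    · rw [hL0]
    · rw [hm]
    · intro r hr hlt
      have hlt' : L m r < α r := by linarith
      have et : tr r (L m r) = α r := by
        simp only [tr, hpri r hr]
        rw [min_eq_right (hlt'.le.trans (hαβ r (hsub hr))), max_eq_left hlt'.le]
      simp only [F, et, hpri r hr, div_eq_mul_inv, fz_neg]
      have : max (-2) (min 2 (L m r)) < α r :=
        max_lt (by linarith [hα1 r (hsub hr)]) (min_lt_of_right_lt hlt')
      linarith
  refine ⟨L m, V m, fun r hr => ⟨(hLm r hr).1, ?_⟩, fun r hr => ⟨by linarith [hlo r hr], hup r hr⟩⟩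
  have e1 := hup r hr
  have e2 := hlo r hr
  have et : tr r (L m r) = L m r := by
    simp only [tr, hpri r hr]
    rw [min_eq_right e1, max_eq_right (by linarith)]
  have := (hLm r hr).2
  simp only [F, et, hpri r hr] at this
  have e3 : max (-2) (min 2 (L m r)) = L m r := by
    have := hα1 r (hsub hr)
    have := hβ1 r (hsub hr)
    rw [min_eq_right (by linarith), max_eq_right (by linarith)]
  rw [e3, sub_self, add_zero] at this
  rwa [div_eq_mul_inv]


lemma fz_div_lip (σ : ℝ → ℝ) (S r x x' : ℝ) (hS : (σ r)⁻¹ ≤ S) (hi : 0 ≤ (σ r)⁻¹)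
    (h1 : -1 ≤ x) (h2 : x ≤ 1) (h3 : -1 ≤ x') (h4 : x' ≤ 1) :
    |fz x / σ r - fz x' / σ r| ≤ (2 * S) * |x - x'| := by
  rw [div_eq_mul_inv, div_eq_mul_inv, ← sub_mul, abs_mul, abs_of_nonneg hi]
  have := mul_le_mul (fz_lip x x' h1 h2 h3 h4) hS hi (by positivity)
  linarith

lemma uniq (σ : ℝ → ℝ) (hσ : ContinuousOn σ (Ioo (-1) 1)) (hσp : ∀ r ∈ Ioo (-1 : ℝ) 1, 0 < σ r)
    (a b : ℝ) (ha : -1 < a) (hb : b < 1) (l v l' v' : ℝ → ℝ)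
    (h : SolOn σ (Icc a b) l v) (h' : SolOn σ (Icc a b) l' v')
    (hl : ∀ r ∈ Icc a b, -1 ≤ l r ∧ l r ≤ 1) (hl' : ∀ r ∈ Icc a b, -1 ≤ l' r ∧ l' r ≤ 1)
    (r0 : ℝ) (hr0 : r0 ∈ Icc a b) (e1 : l r0 = l' r0) (e2 : v r0 = v' r0) :
    ∀ r ∈ Icc a b, l r = l' r ∧ v r = v' r := by
  obtain ⟨S, hS0, hS⟩ := sig_bound σ hσ hσp a b ha hb
  intro r hr
  have := gron (2 * S) (by linarith) a b r0 hr0 l v l' v' _ _ h h'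
    (fun r hr => fz_div_lip σ S r _ _ (hS r hr)
      (inv_pos.2 (hσp r ⟨by linarith [hr.1], by linarith [hr.2]⟩)).le
      (hl r hr).1 (hl r hr).2 (hl' r hr).1 (hl' r hr).2) r hr
  rw [e1, e2] at this
  simp only [sub_self, ne_eq, OfNat.ofNat_ne_zero, not_false_eq_true, zero_pow, add_zero,
    zero_mul] at this
  constructor <;> nlinarith [sq_nonneg (l r - l' r), sq_nonneg (v r - v' r)]

/-- Initial data at `0` of solutions on `[a,b]` lying between `α` and `β`. -/
def KS (σ α β : ℝ → ℝ) (a b : ℝ) : Set (ℝ × ℝ) :=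
  {z | ∃ l v, SolOn σ (Icc a b) l v ∧ (∀ r ∈ Icc a b, α r ≤ l r ∧ l r ≤ β r) ∧
    l 0 = z.1 ∧ v 0 = z.2}

lemma KS_closed (σ : ℝ → ℝ) (hσ : ContinuousOn σ (Ioo (-1) 1))
    (hσp : ∀ r ∈ Ioo (-1 : ℝ) 1, 0 < σ r) (α β : ℝ → ℝ)
    (hα1 : ∀ r ∈ Ioo (-1 : ℝ) 1, -1 ≤ α r) (hβ1 : ∀ r ∈ Ioo (-1 : ℝ) 1, β r ≤ 1)
    (a b : ℝ) (ha : -1 < a) (ha0 : a ≤ 0) (hb0 : 0 ≤ b) (hb : b < 1) :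
    IsClosed (KS σ α β a b) := by
  have hsub : Icc a b ⊆ Ioo (-1 : ℝ) 1 := fun r hr => ⟨by linarith [hr.1], by linarith [hr.2]⟩
  obtain ⟨S, hS0, hS⟩ := sig_bound σ hσ hσp a b ha hb
  let pr : ℝ → ℝ := fun r => max a (min b r)
  have hprm : ∀ r, pr r ∈ Icc a b := fun r =>
    ⟨le_max_left _ _, max_le (ha0.trans hb0) (min_le_left _ _)⟩
  have hpri : ∀ r ∈ Icc a b, pr r = r := fun r hr => by
    simp only [pr]; rw [min_eq_right hr.2, max_eq_right hr.1]
  have hprc : Continuous pr := by fun_prop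
  let tr : ℝ → ℝ := fun x => max (-1) (min 1 x)
  have htr1 : ∀ x, -1 ≤ tr x := fun x => le_max_left _ _
  have htr2 : ∀ x, tr x ≤ 1 := fun x => max_le (by norm_num) (min_le_left _ _)
  have htri : ∀ x, -1 ≤ x → x ≤ 1 → tr x = x := fun x h1 h2 => by
    simp only [tr]; rw [min_eq_right h2, max_eq_right h1]
  let F : ℝ → ℝ → ℝ := fun r x => fz (tr x) / σ (pr r)
  have hi0 : ∀ r, 0 ≤ (σ (pr r))⁻¹ := fun r => (inv_pos.2 (hσp _ (hsub (hprm r)))).le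
  have hFc : ∀ x, Continuous fun r => F r x := fun x =>
    continuous_const.div (hσ.comp_continuous hprc fun r => hsub (hprm r))
      fun r => (hσp _ (hsub (hprm r))).ne'
  have hFb : ∀ r x, |F r x| ≤ S := by
    intro r x
    simp only [F]
    rw [div_eq_mul_inv, abs_mul, abs_of_nonneg (hi0 r)]
    have := mul_le_mul (fz_abs _ (htr1 x) (htr2 x)) (hS _ (hprm r)) (hi0 r) zero_le_one
    linarith
  have hFl : ∀ r x x', |F r x - F r x'| ≤ (2 * S) * |x - x'| := by
    intro r x x'
    have e1 := fz_div_lip σ S (pr r) (tr x) (tr x') (hS _ (hprm r)) (hi0 r) (htr1 x) (htr2 x)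
      (htr1 x') (htr2 x')
    have e2 : |tr x - tr x'| ≤ |x - x'| := clamp_lip _ _ _ _
    exact e1.trans (mul_le_mul_of_nonneg_left e2 (by linarith))
  have h0 : (0 : ℝ) ∈ Icc a b := ⟨ha0, hb0⟩
  have hsub' : Icc a b ⊆ Icc (-1 : ℝ) 1 := fun r hr => Ioo_subset_Icc_self (hsub hr)
  apply IsSeqClosed.isClosed
  intro z z0 hz hlim
  obtain ⟨l, v, hl0, hv0, hlv⟩ := ivp F S (2 * S) hS0 hFc hFb hFl 0 (by norm_num) z0.1 z0.2
  choose L V hLs hLb hL0 hV0 using hz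
  have hconv : ∀ r ∈ Icc a b, Tendsto (fun n => L n r) atTop (𝓝 (l r)) := by
    intro r hr
    have hest : ∀ n, (L n r - l r) ^ 2 ≤ (((z n).1 - z0.1) ^ 2 + ((z n).2 - z0.2) ^ 2) *
        Real.exp ((1 + 2 * S) * |r - 0|) := by
      intro n
      have := gron (2 * S) (by linarith) a b 0 h0 (L n) (V n) l v _ _
        (hLs n) (fun r hr => hlv r (hsub' hr))
        (fun r hr => by
          have e1 := hα1 r (hsub hr)
          have e2 := hβ1 r (hsub hr)
          have e3 := hLb n r hr
          have := hFl r (L n r) (l r)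
          have e4 : F r (L n r) = fz (L n r) / σ r := by
            simp only [F, hpri r hr]
            rw [htri _ (by linarith) (by linarith)]
          rwa [e4] at this) r hr
      rw [hL0, hV0, hl0, hv0] at this
      nlinarith [sq_nonneg (V n r - v r)]
    have ht : Tendsto (fun n => (((z n).1 - z0.1) ^ 2 + ((z n).2 - z0.2) ^ 2) *
        Real.exp ((1 + 2 * S) * |r - 0|)) atTop (𝓝 0) := by
      have hc : Continuous (fun z : ℝ × ℝ => ((z.1 - z0.1) ^ 2 + (z.2 - z0.2) ^ 2) *
        Real.exp ((1 + 2 * S) * |r - 0|)) := by fun_prop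
      have := (hc.tendsto z0).comp hlim
      simpa [Function.comp_def] using this
    have h1 : Tendsto (fun n => (L n r - l r) ^ 2) atTop (𝓝 0) :=
      squeeze_zero (fun _ => sq_nonneg _) hest ht
    have h2 : Tendsto (fun n => |L n r - l r|) atTop (𝓝 0) := by
      have := (Real.continuous_sqrt.tendsto 0).comp h1
      simpa [Function.comp_def, Real.sqrt_sq_eq_abs] using this
    exact tendsto_iff_dist_tendsto_zero.2 (by simpa [Real.dist_eq] using h2)
  have hbd : ∀ r ∈ Icc a b, α r ≤ l r ∧ l r ≤ β r := fun r hr =>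
    ⟨ge_of_tendsto' (hconv r hr) fun n => (hLb n r hr).1,
      le_of_tendsto' (hconv r hr) fun n => (hLb n r hr).2⟩
  refine ⟨l, v, fun r hr => ⟨(hlv r (hsub' hr)).1, ?_⟩, hbd, hl0, hv0⟩
  have := (hlv r (hsub' hr)).2
  have e1 := hα1 r (hsub hr)
  have e2 := hβ1 r (hsub hr)
  have e3 := hbd r hr
  simp only [F, hpri r hr] at this
  rwa [htri _ (by linarith) (by linarith)] at this

lemma KS_bdd (σ : ℝ → ℝ) (hσ : ContinuousOn σ (Ioo (-1) 1))
    (hσp : ∀ r ∈ Ioo (-1 : ℝ) 1, 0 < σ r) (α β : ℝ → ℝ)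
    (hα1 : ∀ r ∈ Ioo (-1 : ℝ) 1, -1 ≤ α r) (hβ1 : ∀ r ∈ Ioo (-1 : ℝ) 1, β r ≤ 1) :
    ∃ Q : ℝ, ∀ a b : ℝ, a ≤ 0 → 1 / 2 ≤ b →
      KS σ α β a b ⊆ Icc (-1 : ℝ) 1 ×ˢ Icc (-Q) Q := by
  obtain ⟨S, hS0, hS⟩ := sig_bound σ hσ hσp 0 (1 / 2) (by norm_num) (by norm_num)
  refine ⟨4 + S, fun a b ha hb z hz => ?_⟩
  obtain ⟨l, v, hs, hbd, h0, hv⟩ := hz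
  have hsub : Icc (0 : ℝ) (1 / 2) ⊆ Icc a b := Icc_subset_Icc ha hb
  have hb1 : ∀ r ∈ Icc (0 : ℝ) (1 / 2), -1 ≤ l r ∧ l r ≤ 1 := by
    intro r hr
    have hr' : r ∈ Ioo (-1 : ℝ) 1 := ⟨by linarith [hr.1], by linarith [hr.2]⟩
    exact ⟨(hα1 r hr').trans (hbd r (hsub hr)).1, (hbd r (hsub hr)).2.trans (hβ1 r hr')⟩
  have m0 : (0 : ℝ) ∈ Icc (0 : ℝ) (1 / 2) := by constructor <;> norm_num
  have m1 : (1 / 2 : ℝ) ∈ Icc (0 : ℝ) (1 / 2) := by constructor <;> norm_num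
  obtain ⟨c, hc, hce⟩ := exists_hasDerivAt_eq_slope l v (by norm_num : (0 : ℝ) < 1 / 2)
    (fun x hx => (hs x (hsub hx)).1.continuousAt.continuousWithinAt)
    (fun x hx => (hs x (hsub (Ioo_subset_Icc_self hx))).1)
  have hdiff := (convex_Icc (0 : ℝ) (1 / 2)).norm_image_sub_le_of_norm_hasDerivWithin_le
      (f := v) (C := S)
      (fun x hx => (hs x (hsub hx)).2.hasDerivWithinAt)
      (fun x hx => by
        have hi : 0 ≤ (σ x)⁻¹ :=
          (inv_pos.2 (hσp x ⟨by linarith [hx.1], by linarith [hx.2]⟩)).le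
        rw [Real.norm_eq_abs, div_eq_mul_inv, abs_mul, abs_of_nonneg hi]
        have := mul_le_mul (fz_abs _ (hb1 x hx).1 (hb1 x hx).2) (hS _ hx) hi zero_le_one
        linarith) m0 (Ioo_subset_Icc_self hc)
  have hvc : |v c| ≤ 4 := by
    have := hb1 0 m0
    have := hb1 _ m1
    have hce' : v c = 2 * (l (1 / 2) - l 0) := by rw [hce]; ring
    rw [hce', abs_le]
    constructor <;> linarith
  rw [Real.norm_eq_abs, Real.norm_eq_abs, sub_zero, abs_of_pos hc.1] at hdiff
  have hdiff' : |v c - v 0| ≤ S := hdiff.trans (by nlinarith [hc.2])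
  have k1 := abs_le.1 hdiff'
  have k2 := abs_le.1 hvc
  refine ⟨?_, ?_⟩
  · rw [← h0]; exact hb1 0 m0
  · rw [← hv]; constructor <;> linarith

lemma exists_min (σ : ℝ → ℝ) (hσ : ContinuousOn σ (Ioo (-1) 1))
    (hσp : ∀ r ∈ Ioo (-1 : ℝ) 1, 0 < σ r)
    (α β : ℝ → ℝ) (hα : ContinuousOn α (Ioo (-1) 1)) (hβ : ContinuousOn β (Ioo (-1) 1))
    (hα1 : ∀ r ∈ Ioo (-1 : ℝ) 1, -1 ≤ α r) (hαβ : ∀ r ∈ Ioo (-1 : ℝ) 1, α r ≤ β r)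
    (hβ1 : ∀ r ∈ Ioo (-1 : ℝ) 1, β r ≤ 1)
    (hsb : IsSuper σ (fun r => - α r)) (hsp : IsSuper σ β) :
    ∃ l v, SolOn σ (Ioo (-1) 1) l v ∧ (∀ r ∈ Ioo (-1 : ℝ) 1, α r ≤ l r ∧ l r ≤ β r) ∧
      ∀ l2 v2, SolOn σ (Ioo (-1) 1) l2 v2 →
        (∀ r ∈ Ioo (-1 : ℝ) 1, α r ≤ l2 r ∧ l2 r ≤ β r) → l 0 ≤ l2 0 := by
  let e : ℕ → ℝ := fun n => 1 - 1 / ((n : ℝ) + 2)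
  have he1 : ∀ n, e n < 1 := fun n => by
    have : (0 : ℝ) < 1 / ((n : ℝ) + 2) := by positivity
    simp only [e]; linarith
  have he2 : ∀ n, 1 / 2 ≤ e n := fun n => by
    have : 1 / ((n : ℝ) + 2) ≤ 1 / 2 :=
      one_div_le_one_div_of_le (by norm_num) (by linarith [(Nat.cast_nonneg n : (0 : ℝ) ≤ n)])
    simp only [e]; linarith
  have hem : Monotone e := by
    intro m n hmn
    have h1 : (m : ℝ) ≤ n := by exact_mod_cast hmn
    have h0 : (0 : ℝ) ≤ m := Nat.cast_nonneg m
    have := one_div_le_one_div_of_le (by linarith : (0 : ℝ) < (m : ℝ) + 2)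
      (by linarith : (m : ℝ) + 2 ≤ (n : ℝ) + 2)
    simp only [e]; linarith
  have hee : ∀ r ∈ Ioo (-1 : ℝ) 1, ∃ n, r ∈ Ioo (-e n) (e n) := by
    intro r hr
    have hr1 : |r| < 1 := abs_lt.2 hr
    obtain ⟨n, hn⟩ := exists_nat_one_div_lt (by linarith : 0 < 1 - |r|)
    refine ⟨n, ?_⟩
    have h3 : 1 / ((n : ℝ) + 2) ≤ 1 / ((n : ℝ) + 1) :=
      one_div_le_one_div_of_le (by positivity) (by linarith)
    exact abs_lt.1 (by simp only [e]; linarith)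
  have hesub : ∀ n, Icc (-e n) (e n) ⊆ Ioo (-1 : ℝ) 1 := fun n r hr =>
    ⟨by linarith [hr.1, he1 n], by linarith [hr.2, he1 n]⟩
  let K : ℕ → Set (ℝ × ℝ) := fun n => KS σ α β (-e n) (e n)
  have hKcl : ∀ n, IsClosed (K n) := fun n => KS_closed σ hσ hσp α β hα1 hβ1 _ _
    (by linarith [he1 n]) (by linarith [he2 n]) (by linarith [he2 n]) (he1 n)
  obtain ⟨Q, hQ⟩ := KS_bdd σ hσ hσp α β hα1 hβ1
  have hKsub : ∀ n, K n ⊆ Icc (-1 : ℝ) 1 ×ˢ Icc (-Q) Q := fun n =>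
    hQ _ _ (by linarith [he2 n]) (he2 n)
  have hKc : ∀ n, IsCompact (K n) := fun n =>
    (isCompact_Icc.prod isCompact_Icc).of_isClosed_subset (hKcl n) (hKsub n)
  have hKne : ∀ n, (K n).Nonempty := by
    intro n
    obtain ⟨l, v, h1, h2⟩ := shoot σ hσ hσp α β hα hβ hα1 hαβ hβ1 hsb hsp (-e n) (e n)
      (by linarith [he1 n]) (by linarith [he2 n]) (he1 n)
    exact ⟨(l 0, v 0), l, v, h1, h2, rfl, rfl⟩
  have hKanti : ∀ n, K (n + 1) ⊆ K n := by
    rintro n z ⟨l, v, h1, h2, h3⟩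
    have hs : Icc (-e n) (e n) ⊆ Icc (-e (n + 1)) (e (n + 1)) :=
      Icc_subset_Icc (by linarith [hem (Nat.le_succ n)]) (hem (Nat.le_succ n))
    exact ⟨l, v, fun r hr => h1 r (hs hr), fun r hr => h2 r (hs hr), h3⟩
  have hne : (⋂ n, K n).Nonempty :=
    IsCompact.nonempty_iInter_of_sequence_nonempty_isCompact_isClosed K hKanti hKne (hKc 0) hKcl
  have hcp : IsCompact (⋂ n, K n) :=
    (hKc 0).of_isClosed_subset (isClosed_iInter hKcl) (iInter_subset _ 0)
  obtain ⟨z, hz, hzmin⟩ := hcp.exists_isMinOn hne continuous_fst.continuousOn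
  rw [mem_iInter] at hz
  choose L V hLs hLb hL0 hV0 using hz
  have hb1 : ∀ n, ∀ r ∈ Icc (-e n) (e n), -1 ≤ L n r ∧ L n r ≤ 1 := fun n r hr =>
    ⟨(hα1 r (hesub n hr)).trans (hLb n r hr).1, (hLb n r hr).2.trans (hβ1 r (hesub n hr))⟩
  have hcons : ∀ m n, m ≤ n → ∀ r ∈ Icc (-e m) (e m), L m r = L n r ∧ V m r = V n r := by
    intro m n hmn
    have hs : Icc (-e m) (e m) ⊆ Icc (-e n) (e n) :=
      Icc_subset_Icc (by linarith [hem hmn]) (hem hmn)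
    exact uniq σ hσ hσp _ _ (by linarith [he1 m]) (he1 m) (L m) (V m) (L n) (V n) (hLs m)
      (fun r hr => hLs n r (hs hr)) (hb1 m) (fun r hr => hb1 n r (hs hr)) 0
      ⟨by linarith [he2 m], by linarith [he2 m]⟩ (by rw [hL0, hL0]) (by rw [hV0, hV0])
  have hcons' : ∀ m n r, r ∈ Icc (-e m) (e m) → r ∈ Icc (-e n) (e n) →
      L m r = L n r ∧ V m r = V n r := by
    intro m n r h1 h2
    rcases le_total m n with h | h
    · exact hcons m n h r h1
    · exact ⟨(hcons n m h r h2).1.symm, (hcons n m h r h2).2.symm⟩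
  choose! N hN using hee
  let l : ℝ → ℝ := fun r => L (N r) r
  let v : ℝ → ℝ := fun r => V (N r) r
  have hlL : ∀ n, ∀ r ∈ Ioo (-e n) (e n), l r = L n r ∧ v r = V n r := fun n r hr =>
    hcons' _ _ r (Ioo_subset_Icc_self (hN r (hesub n (Ioo_subset_Icc_self hr))))
      (Ioo_subset_Icc_self hr)
  refine ⟨l, v, ?_, fun r hr => hLb _ r (Ioo_subset_Icc_self (hN r hr)), ?_⟩
  · intro r hr
    have hev : Ioo (-e (N r)) (e (N r)) ∈ 𝓝 r := Ioo_mem_nhds (hN r hr).1 (hN r hr).2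
    have h1 : l =ᶠ[𝓝 r] L (N r) := by
      filter_upwards [hev] with x hx using (hlL _ x hx).1
    have h2 : v =ᶠ[𝓝 r] V (N r) := by
      filter_upwards [hev] with x hx using (hlL _ x hx).2
    have := hLs (N r) r (Ioo_subset_Icc_self (hN r hr))
    exact ⟨this.1.congr_of_eventuallyEq h1, this.2.congr_of_eventuallyEq h2⟩
  · intro l2 v2 h2 hb2
    have hm : ((l2 0, v2 0) : ℝ × ℝ) ∈ ⋂ n, K n := by
      rw [mem_iInter]
      intro n
      exact ⟨l2, v2, fun r hr => h2 r (hesub n hr), fun r hr => hb2 r (hesub n hr), rfl, rfl⟩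
    have h3 : z.1 ≤ l2 0 := hzmin hm
    have h4 : l 0 = z.1 := hL0 _
    rw [h4]; exact h3


lemma uniqI (σ : ℝ → ℝ) (hσ : ContinuousOn σ (Ioo (-1) 1)) (hσp : ∀ r ∈ Ioo (-1 : ℝ) 1, 0 < σ r)
    (l v l' v' : ℝ → ℝ)
    (h : SolOn σ (Ioo (-1) 1) l v) (h' : SolOn σ (Ioo (-1) 1) l' v')
    (hl : ∀ r ∈ Ioo (-1 : ℝ) 1, -1 ≤ l r ∧ l r ≤ 1)
    (hl' : ∀ r ∈ Ioo (-1 : ℝ) 1, -1 ≤ l' r ∧ l' r ≤ 1)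
    (r0 : ℝ) (hr0 : r0 ∈ Ioo (-1 : ℝ) 1) (e1 : l r0 = l' r0) (e2 : v r0 = v' r0) :
    ∀ r ∈ Ioo (-1 : ℝ) 1, l r = l' r ∧ v r = v' r := by
  intro r hr
  have ha : -1 < min r r0 := lt_min hr.1 hr0.1
  have hb : max r r0 < 1 := max_lt hr.2 hr0.2
  have hs : Icc (min r r0) (max r r0) ⊆ Ioo (-1 : ℝ) 1 := fun x hx =>
    ⟨by linarith [hx.1], by linarith [hx.2]⟩
  exact uniq σ hσ hσp _ _ ha hb l v l' v' (fun x hx => h x (hs hx)) (fun x hx => h' x (hs hx))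
    (fun x hx => hl x (hs hx)) (fun x hx => hl' x (hs hx)) r0
    ⟨min_le_right _ _, le_max_right _ _⟩ e1 e2 r ⟨min_le_left _ _, le_max_left _ _⟩

lemma const_uniq (σ : ℝ → ℝ) (hσ : ContinuousOn σ (Ioo (-1) 1))
    (hσp : ∀ r ∈ Ioo (-1 : ℝ) 1, 0 < σ r) (l v : ℝ → ℝ)
    (h : SolOn σ (Ioo (-1) 1) l v) (hl : ∀ r ∈ Ioo (-1 : ℝ) 1, -1 ≤ l r ∧ l r ≤ 1)
    (c : ℝ) (hc : fz c = 0) (hc1 : -1 ≤ c) (hc2 : c ≤ 1)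
    (r0 : ℝ) (hr0 : r0 ∈ Ioo (-1 : ℝ) 1) (e1 : l r0 = c) (e2 : v r0 = 0) :
    ∀ r ∈ Ioo (-1 : ℝ) 1, l r = c := by
  intro r hr
  refine (uniqI σ hσ hσp l v (fun _ => c) (fun _ => 0) h ?_ hl (fun _ _ => ⟨hc1, hc2⟩) r0 hr0 e1 e2
    r hr).1
  intro x hx
  refine ⟨hasDerivAt_const _ _, ?_⟩
  simp only [hc, zero_div]
  exact hasDerivAt_const _ _

lemma mono_key (σ : ℝ → ℝ) (hσ : ContinuousOn σ (Ioo (-1) 1))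
    (hσp : ∀ r ∈ Ioo (-1 : ℝ) 1, 0 < σ r)
    (α β : ℝ → ℝ) (hα : ContinuousOn α (Ioo (-1) 1))
    (hα1 : ∀ r ∈ Ioo (-1 : ℝ) 1, -1 ≤ α r)
    (hβ1 : ∀ r ∈ Ioo (-1 : ℝ) 1, β r ≤ 1)
    (hsb : IsSuper σ (fun r => - α r))
    (hαm : MonotoneOn α (Ioo (-1) 1)) (l v : ℝ → ℝ) (hs : SolOn σ (Ioo (-1) 1) l v)
    (hb : ∀ r ∈ Ioo (-1 : ℝ) 1, α r ≤ l r ∧ l r ≤ β r)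
    (hmin : ∀ l2 v2, SolOn σ (Ioo (-1) 1) l2 v2 →
        (∀ r ∈ Ioo (-1 : ℝ) 1, α r ≤ l2 r ∧ l2 r ≤ β r) → l 0 ≤ l2 0)
    (q : ℝ) (hq : q ∈ Ioo (-1 : ℝ) 1) (hlq : l q ≤ 0) :
    ∀ s ∈ Ioo (-1 : ℝ) 1, s ≤ q → l s ≤ l q := by
  have hlc : ContinuousOn l (Ioo (-1) 1) := fun r hr => (hs r hr).1.continuousAt.continuousWithinAt
  have hb1 : ∀ r ∈ Ioo (-1 : ℝ) 1, -1 ≤ l r ∧ l r ≤ 1 := fun r hr =>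
    ⟨(hα1 r hr).trans (hb r hr).1, (hb r hr).2.trans (hβ1 r hr)⟩
  have hmx : ∀ r ∈ Ioo (-1 : ℝ) 1, max r q ∈ Ioo (-1 : ℝ) 1 := fun r hr =>
    ⟨lt_max_of_lt_left hr.1, max_lt hr.2 hq.2⟩
  let m : ℝ → ℝ := fun r => min (l r) (l (max r q))
  have hml : ∀ r, m r ≤ l r := fun r => min_le_left _ _
  have hmc : ContinuousOn m (Ioo (-1) 1) :=
    continuous_min.comp_continuousOn (hlc.prodMk (hlc.comp (by fun_prop) hmx))
  have hαm' : ∀ r ∈ Ioo (-1 : ℝ) 1, α r ≤ m r := by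
    intro r hr
    refine le_min (hb r hr).1 ?_
    exact (hαm hr (hmx r hr) (le_max_left _ _)).trans (hb _ (hmx r hr)).1
  have hsm : IsSuper σ m := by
    intro r0 hr0
    have hnh : Ioo (-1 : ℝ) 1 ∈ 𝓝 r0 := Ioo_mem_nhds hr0.1 hr0.2
    by_cases hcase : m r0 = l r0
    · refine ⟨l, v, fz (l r0) / σ r0, ?_, (hs r0 hr0).2, hcase.symm,
        Eventually.of_forall hml, by rw [hcase]⟩
      filter_upwards [hnh] with r hr using (hs r hr).1
    · have h1 : r0 < q := by
        by_contra! h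
        apply hcase
        simp only [m]; rw [max_eq_left h, min_self]
      have h2 : m r0 = l q := by
        simp only [m] at hcase ⊢
        rw [max_eq_right h1.le] at hcase ⊢
        rcases min_choice (l r0) (l q) with h | h
        · exact absurd h hcase
        · exact h
      refine ⟨fun _ => l q, fun _ => 0, 0, Eventually.of_forall fun r => hasDerivAt_const _ _,
        hasDerivAt_const _ _, h2.symm, ?_, ?_⟩
      · filter_upwards [Iio_mem_nhds h1] with r hr
        simp only [m]
        rw [max_eq_right (le_of_lt hr)]
        exact min_le_right _ _
      · rw [h2]
        apply div_nonneg _ (hσp r0 hr0).le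
        have := (hb1 q hq).1
        unfold fz
        nlinarith [mul_nonneg (mul_nonneg (by linarith : 0 ≤ - l q) (by linarith : 0 ≤ 1 + l q))
          (by linarith : 0 ≤ 1 - l q)]
  obtain ⟨l2, v2, hs2, hb2, -⟩ := exists_min σ hσ hσp α m hα hmc hα1 hαm'
    (fun r hr => (hml r).trans (hb1 r hr).2) hsb hsm
  have h0m : (0 : ℝ) ∈ Ioo (-1 : ℝ) 1 := by constructor <;> norm_num
  have hle : ∀ r ∈ Ioo (-1 : ℝ) 1, l2 r ≤ l r := fun r hr => (hb2 r hr).2.trans (hml r)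
  have h0 : l 0 = l2 0 := le_antisymm
    (hmin l2 v2 hs2 fun r hr => ⟨(hb2 r hr).1, (hle r hr).trans (hb r hr).2⟩) (hle 0 h0m)
  have hloc : IsLocalMax (fun r => l2 r - l r) 0 := by
    filter_upwards [Ioo_mem_nhds h0m.1 h0m.2] with r hr
    have := hle r hr
    rw [h0]; linarith
  have hv : v2 0 - v 0 = 0 := hloc.hasDerivAt_eq_zero ((hs2 0 h0m).1.sub (hs 0 h0m).1)
  have heq := uniqI σ hσ hσp l v l2 v2 hs hs2 hb1
    (fun r hr => ⟨(hα1 r hr).trans (hb2 r hr).1, (hle r hr).trans (hb1 r hr).2⟩) 0 h0m h0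
    (by linarith)
  intro s hsm' hsq
  rw [(heq s hsm').1]
  refine (hb2 s hsm').2.trans ?_
  simp only [m]
  rw [max_eq_right hsq]
  exact min_le_right _ _

lemma exists_mono (σ : ℝ → ℝ) (hσ : ContinuousOn σ (Ioo (-1) 1))
    (hσp : ∀ r ∈ Ioo (-1 : ℝ) 1, 0 < σ r)
    (α β : ℝ → ℝ) (hα : ContinuousOn α (Ioo (-1) 1)) (hβ : ContinuousOn β (Ioo (-1) 1))
    (hα1 : ∀ r ∈ Ioo (-1 : ℝ) 1, -1 ≤ α r) (hαβ : ∀ r ∈ Ioo (-1 : ℝ) 1, α r ≤ β r)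
    (hβ1 : ∀ r ∈ Ioo (-1 : ℝ) 1, β r ≤ 1)
    (hsb : IsSuper σ (fun r => - α r)) (hsp : IsSuper σ β)
    (hαm : MonotoneOn α (Ioo (-1) 1)) (k : ℝ) (hk : 0 < k)
    (hαk : ∀ r ∈ Ioo (-1 : ℝ) 1, 1 - k * (1 - r) ≤ α r)
    (hβk : ∀ r ∈ Ioo (-1 : ℝ) 1, β r ≤ -1 + k * (1 + r)) :
    ∃ l v, SolOn σ (Ioo (-1) 1) l v ∧
      (∀ r ∈ Ioo (-1 : ℝ) 1, -1 < l r ∧ l r < 1 ∧ 0 < v r ∧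
        l r ≤ -1 + k * (1 + r) ∧ 1 - k * (1 - r) ≤ l r) := by
  obtain ⟨l, v, hs, hb, hmin⟩ := exists_min σ hσ hσp α β hα hβ hα1 hαβ hβ1 hsb hsp
  have key := mono_key σ hσ hσp α β hα hα1 hβ1 hsb hαm l v hs hb hmin
  have hb1 : ∀ r ∈ Ioo (-1 : ℝ) 1, -1 ≤ l r ∧ l r ≤ 1 := fun r hr =>
    ⟨(hα1 r hr).trans (hb r hr).1, (hb r hr).2.trans (hβ1 r hr)⟩
  have hup : ∀ r ∈ Ioo (-1 : ℝ) 1, l r ≤ -1 + k * (1 + r) := fun r hr =>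
    (hb r hr).2.trans (hβk r hr)
  have hlo : ∀ r ∈ Ioo (-1 : ℝ) 1, 1 - k * (1 - r) ≤ l r := fun r hr =>
    (hαk r hr).trans (hb r hr).1
  -- small points near the ends
  have hsmallL : ∀ c : ℝ, 0 < c → ∀ r ∈ Ioo (-1 : ℝ) 1, ∃ s ∈ Ioo (-1 : ℝ) 1, s < r ∧
      k * (1 + s) < c := by
    intro c hc r hr
    have h1 : -1 < min r (-1 + c / k) := lt_min hr.1 (by
      have : 0 < c / k := by positivity
      linarith)
    obtain ⟨s, hs1, hs2⟩ := exists_between h1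
    have hs3 := lt_min_iff.1 hs2
    refine ⟨s, ⟨hs1, by linarith [hr.2]⟩, hs3.1, ?_⟩
    have : 1 + s < c / k := by linarith
    rw [lt_div_iff₀ hk] at this
    linarith
  have hsmallR : ∀ c : ℝ, 0 < c → ∀ r ∈ Ioo (-1 : ℝ) 1, ∃ s ∈ Ioo (-1 : ℝ) 1, r < s ∧
      k * (1 - s) < c := by
    intro c hc r hr
    obtain ⟨s, hs1, hs2, hs3⟩ := hsmallL c hc (-r) ⟨by linarith [hr.2], by linarith [hr.1]⟩
    exact ⟨-s, ⟨by linarith [hs1.2], by linarith [hs1.1]⟩, by linarith, by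
      rwa [sub_neg_eq_add]⟩
  have h0m : (0 : ℝ) ∈ Ioo (-1 : ℝ) 1 := by constructor <;> norm_num
  have hnh : ∀ r ∈ Ioo (-1 : ℝ) 1, Ioo (-1 : ℝ) 1 ∈ 𝓝 r := fun r hr => Ioo_mem_nhds hr.1 hr.2
  have hlt1 : ∀ r ∈ Ioo (-1 : ℝ) 1, l r < 1 := by
    intro r hr
    refine lt_of_le_of_ne (hb1 r hr).2 fun he => ?_
    have hloc : IsLocalMax l r := by
      filter_upwards [hnh r hr] with x hx
      rw [he]; exact (hb1 x hx).2
    have hv := hloc.hasDerivAt_eq_zero (hs r hr).1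
    have hall := const_uniq σ hσ hσp l v hs hb1 1 (by norm_num [fz]) (by norm_num) le_rfl r hr he hv
    obtain ⟨s, hs1, -, hs3⟩ := hsmallL 1 one_pos 0 h0m
    have := hall s hs1
    have := hup s hs1
    linarith
  have hgt1 : ∀ r ∈ Ioo (-1 : ℝ) 1, -1 < l r := by
    intro r hr
    refine lt_of_le_of_ne (hb1 r hr).1 fun he => ?_
    have hloc : IsLocalMin l r := by
      filter_upwards [hnh r hr] with x hx
      rw [← he]; exact (hb1 x hx).1
    have hv := hloc.hasDerivAt_eq_zero (hs r hr).1
    have hall := const_uniq σ hσ hσp l v hs hb1 (-1) (by norm_num [fz]) le_rfl (by norm_num) r hr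
      he.symm hv
    obtain ⟨s, hs1, -, hs3⟩ := hsmallR 1 one_pos 0 h0m
    have := hall s hs1
    have := hlo s hs1
    linarith
  have mvt : ∀ s ∈ Ioo (-1 : ℝ) 1, ∀ r ∈ Ioo (-1 : ℝ) 1, s < r →
      ∃ c ∈ Ioo s r, l r - l s = v c * (r - s) := by
    intro s hs1 r hr hsr
    have hsub : Icc s r ⊆ Ioo (-1 : ℝ) 1 := fun x hx => ⟨by linarith [hx.1, hs1.1],
      by linarith [hx.2, hr.2]⟩
    obtain ⟨c, hc, hce⟩ := exists_hasDerivAt_eq_slope l v hsr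
      (fun x hx => (hs x (hsub hx)).1.continuousAt.continuousWithinAt)
      (fun x hx => (hs x (hsub (Ioo_subset_Icc_self hx))).1)
    refine ⟨c, hc, ?_⟩
    rw [hce]; field_simp [(by linarith : r - s ≠ 0)]
  refine ⟨l, v, hs, fun r hr => ⟨hgt1 r hr, hlt1 r hr, ?_, hup r hr, hlo r hr⟩⟩
  by_contra! hv
  rcases le_or_gt (l r) 0 with hneg | hpos
  · have hle : ∀ s ∈ Ioo (-1 : ℝ) 1, s ≤ r → l s ≤ l r := key r hr hneg
    have hsub : Ioc (-1) r ⊆ Ioo (-1 : ℝ) 1 := fun x hx => ⟨hx.1, by linarith [hx.2, hr.2]⟩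
    have hvm : MonotoneOn v (Ioc (-1) r) := by
      apply monotoneOn_of_deriv_nonneg (convex_Ioc _ _)
      · exact fun x hx => (hs x (hsub hx)).2.continuousAt.continuousWithinAt
      · exact fun x hx => (hs x (hsub (interior_subset hx))).2.differentiableAt.differentiableWithinAt
      · intro x hx
        have hx' := interior_subset hx
        have hx2 := hsub hx'
        rw [(hs x hx2).2.deriv]
        apply div_nonneg _ (hσp x hx2).le
        have h1 := hgt1 x hx2
        have h2 := hle x hx2 hx'.2
        unfold fz
        nlinarith [mul_nonneg (mul_nonneg (by linarith : 0 ≤ - l x) (by linarith : 0 ≤ 1 + l x))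
          (by linarith : 0 ≤ 1 - l x)]
    obtain ⟨s, hs1, hs2, hs3⟩ := hsmallL (l r + 1) (by linarith [hgt1 r hr]) r hr
    obtain ⟨c, hc, hce⟩ := mvt s hs1 r hr hs2
    have hvc : v c ≤ v r := hvm ⟨by linarith [hc.1, hs1.1], hc.2.le⟩ ⟨hr.1, le_rfl⟩ hc.2.le
    have : v c * (r - s) ≤ 0 := mul_nonpos_of_nonpos_of_nonneg (by linarith) (by linarith)
    have := hup s hs1
    linarith
  · have hge : ∀ s ∈ Ioo (-1 : ℝ) 1, r ≤ s → 0 < l s := by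
      intro s hs1 hrs
      by_contra! hc
      have := key s hs1 hc r hr hrs
      linarith
    have hsub : Ico r 1 ⊆ Ioo (-1 : ℝ) 1 := fun x hx => ⟨by linarith [hx.1, hr.1], hx.2⟩
    have hvm : AntitoneOn v (Ico r 1) := by
      apply antitoneOn_of_deriv_nonpos (convex_Ico _ _)
      · exact fun x hx => (hs x (hsub hx)).2.continuousAt.continuousWithinAt
      · exact fun x hx => (hs x (hsub (interior_subset hx))).2.differentiableAt.differentiableWithinAt
      · intro x hx
        have hx' := interior_subset hx
        have hx2 := hsub hx'
        rw [(hs x hx2).2.deriv]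
        apply div_nonpos_of_nonpos_of_nonneg _ (hσp x hx2).le
        have h1 := hlt1 x hx2
        have h2 := hge x hx2 hx'.1
        unfold fz
        nlinarith [mul_nonneg (mul_nonneg (by linarith : 0 ≤ l x) (by linarith : 0 ≤ 1 + l x))
          (by linarith : 0 ≤ 1 - l x)]
    obtain ⟨s, hs1, hs2, hs3⟩ := hsmallR (1 - l r) (by linarith [hlt1 r hr]) r hr
    obtain ⟨c, hc, hce⟩ := mvt r hr s hs1 hs2
    have hvc : v c ≤ v r := hvm ⟨le_rfl, hr.2⟩ ⟨hc.1.le, by linarith [hc.2, hs1.2]⟩ hc.1.le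
    have : v c * (s - r) ≤ 0 := mul_nonpos_of_nonpos_of_nonneg (by linarith) (by linarith)
    have := hlo s hs1
    linarith


/-- Profile of the barrier. -/
noncomputable def phi (x : ℝ) : ℝ := Real.log (max x 1) + (min x 1 - 1)

/-- The explicit supersolution. -/
noncomputable def bar (t0 r : ℝ) : ℝ := min 1 (phi ((r + 1) / t0))

lemma phi_le (x : ℝ) : phi x ≤ x - 1 := by
  have h := Real.log_le_sub_one_of_pos (lt_of_lt_of_le one_pos (le_max_right x 1))
  have := max_add_min x 1
  unfold phi; linarith

lemma phi_of_le (x : ℝ) (hx : x ≤ 1) : phi x = x - 1 := by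
  unfold phi; rw [max_eq_right hx, min_eq_left hx, Real.log_one, zero_add]

lemma phi_of_ge (x : ℝ) (hx : 1 ≤ x) : phi x = Real.log x := by
  unfold phi; rw [max_eq_left hx, min_eq_right hx, sub_self, add_zero]

lemma phi_cont : Continuous phi := by
  unfold phi
  refine Continuous.add (Continuous.log (by fun_prop) fun x => ?_) (by fun_prop)
  exact (lt_of_lt_of_le one_pos (le_max_right x 1)).ne'

lemma phi_mono : Monotone phi := by
  intro x y h
  unfold phi
  have h1 := Real.log_le_log (lt_of_lt_of_le one_pos (le_max_right x 1))
    (max_le_max_right 1 h)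
  have h2 := min_le_min_right 1 h
  linarith

lemma bar_super (σ : ℝ → ℝ) (hσp : ∀ r ∈ Ioo (-1 : ℝ) 1, 0 < σ r) (t0 : ℝ) (ht0 : 0 < t0)
    (h : ∀ r ∈ Ioo (-1 : ℝ) 1, r + 1 ≤ 3 * t0 → 4 / 9 * (r + 1) ^ 2 ≤ σ r) :
    IsSuper σ (bar t0) := by
  intro r0 hr0
  have hp : 0 < r0 + 1 := by linarith [hr0.1]
  have hx0 : 0 < (r0 + 1) / t0 := by positivity
  rcases le_or_gt ((r0 + 1) / t0) 1 with h1 | h1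
  · have he : bar t0 r0 = (r0 + 1) / t0 - 1 := by
      unfold bar; rw [phi_of_le _ h1, min_eq_right (by linarith)]
    refine ⟨fun r => (r + 1) / t0 - 1, fun _ => 1 / t0, 0, Eventually.of_forall fun r => ?_,
      hasDerivAt_const _ _, he.symm, Eventually.of_forall fun r => ?_, ?_⟩
    · exact (((hasDerivAt_id r).add_const 1).div_const t0).sub_const 1
    · exact (min_le_right _ _).trans (phi_le _)
    · apply div_nonneg _ (hσp r0 hr0).le
      rw [he]
      set x := (r0 + 1) / t0
      unfold fz
      nlinarith [mul_nonneg (mul_nonneg (by linarith : 0 ≤ 1 - x) hx0.le)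
          (by linarith : 0 ≤ 2 - x)]
  · rcases lt_or_ge (Real.log ((r0 + 1) / t0)) 1 with h2 | h2
    · have he : bar t0 r0 = Real.log ((r0 + 1) / t0) := by
        unfold bar; rw [phi_of_ge _ h1.le, min_eq_right h2.le]
      have hev : ∀ᶠ r in 𝓝 r0, 1 < (r + 1) / t0 := by
        have hc : ContinuousAt (fun r : ℝ => (r + 1) / t0) r0 := by fun_prop
        exact hc.eventually (lt_mem_nhds h1)
      refine ⟨fun r => Real.log ((r + 1) / t0), fun r => (r + 1)⁻¹, -((r0 + 1) ^ 2)⁻¹, ?_, ?_,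
        he.symm, ?_, ?_⟩
      · filter_upwards [hev] with r hr
        have hr1 : r + 1 ≠ 0 := by
          intro h0; rw [h0, zero_div] at hr; linarith
        have := (((hasDerivAt_id r).add_const 1).div_const t0).log (by
          simp only [id]; linarith)
        refine this.congr_deriv ?_
        simp only [id]
        field_simp
      · have := ((hasDerivAt_id r0).add_const 1).inv (by simpa using hp.ne')
        refine this.congr_deriv ?_
        simp only [id]
        rw [neg_div, one_div]
      · filter_upwards [hev] with r hr
        unfold bar
        rw [phi_of_ge _ hr.le]
        exact min_le_right _ _
      · rw [he]
        have hl0 : 0 ≤ Real.log ((r0 + 1) / t0) := Real.log_nonneg h1.le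
        have h3 : r0 + 1 ≤ 3 * t0 := by
          have h4 : (r0 + 1) / t0 < Real.exp 1 := (Real.log_lt_iff_lt_exp hx0).1 h2
          have h5 := Real.exp_one_lt_d9
          have h6 : (r0 + 1) / t0 ≤ 3 := by linarith
          rwa [div_le_iff₀ ht0] at h6
        have hs := h r0 hr0 h3
        set z := Real.log ((r0 + 1) / t0)
        have hf : -(2 / 5) ≤ fz z := by
          unfold fz
          nlinarith [mul_nonneg hl0 (sq_nonneg (z - 3 / 5)), sq_nonneg (z - 3 / 5)]
        have hσ0 := hσp r0 hr0
        have hp2 : 0 < (r0 + 1) ^ 2 := by positivity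
        rw [le_div_iff₀ hσ0]
        have h7 : 4 / 9 ≤ ((r0 + 1) ^ 2)⁻¹ * σ r0 := by
          rw [inv_mul_eq_div, le_div_iff₀ hp2]; exact hs
        linarith
    · have he : bar t0 r0 = 1 := by
        unfold bar; rw [phi_of_ge _ h1.le, min_eq_left h2]
      refine ⟨fun _ => 1, fun _ => 0, 0, Eventually.of_forall fun r => hasDerivAt_const _ _,
        hasDerivAt_const _ _, he.symm, Eventually.of_forall fun r => min_le_left _ _, ?_⟩
      rw [he]; norm_num [fz]

lemma super_reflect (σ β : ℝ → ℝ) (h : IsSuper (fun r => σ (-r)) β) :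
    IsSuper σ (fun r => β (-r)) := by
  intro r0 hr0
  obtain ⟨w, w1, w2, h1, h2, h3, h4, h5⟩ := h (-r0) ⟨by linarith [hr0.2], by linarith [hr0.1]⟩
  have ht : Tendsto (fun r : ℝ => -r) (𝓝 r0) (𝓝 (-r0)) := continuous_neg.tendsto r0
  refine ⟨fun r => w (-r), fun r => -w1 (-r), w2, ?_, ?_, h3, ht.eventually h4, ?_⟩
  · filter_upwards [ht.eventually h1] with r hr
    have := hr.scomp r (hasDerivAt_neg r)
    refine this.congr_deriv ?_
    simp
  · have := (h2.scomp r0 (hasDerivAt_neg r0)).neg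
    refine this.congr_deriv ?_
    simp
  · simpa using h5

lemma exists_sol (σ : ℝ → ℝ) (hσ : ContinuousOn σ (Ioo (-1) 1))
    (hσp : ∀ r ∈ Ioo (-1 : ℝ) 1, 0 < σ r) (δ : ℝ) (hδ : 0 < δ)
    (hL : ∀ r ∈ Ioo (-1 : ℝ) 1, r + 1 ≤ δ → 4 / 9 * (r + 1) ^ 2 ≤ σ r)
    (hR : ∀ r ∈ Ioo (-1 : ℝ) 1, 1 - r ≤ δ → 4 / 9 * (1 - r) ^ 2 ≤ σ r) :
    ∃ k > 0, ∃ l v, SolOn σ (Ioo (-1) 1) l v ∧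
      (∀ r ∈ Ioo (-1 : ℝ) 1, -1 < l r ∧ l r < 1 ∧ 0 < v r ∧
        l r ≤ -1 + k * (1 + r) ∧ 1 - k * (1 - r) ≤ l r) := by
  set t0 : ℝ := min (1 / 3) (δ / 3) with ht
  have ht0 : 0 < t0 := lt_min (by norm_num) (by linarith)
  have ht1 : t0 ≤ 1 / 3 := min_le_left _ _
  have ht2 : t0 ≤ δ / 3 := min_le_right _ _
  have hc : Continuous (bar t0) := by
    unfold bar
    exact continuous_const.min (phi_cont.comp (by fun_prop))
  have hm : Monotone (bar t0) := by
    intro x y h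
    unfold bar
    apply min_le_min_left
    apply phi_mono
    gcongr
  have h1 : ∀ r, bar t0 r ≤ 1 := fun r => min_le_left _ _
  have h2 : ∀ r, -1 < r → -1 ≤ bar t0 r := by
    intro r hr
    have hx : 0 ≤ (r + 1) / t0 := div_nonneg (by linarith) ht0.le
    have := phi_mono hx
    rw [phi_of_le 0 (by norm_num)] at this
    exact le_min (by norm_num) (by linarith)
  have h3 : ∀ r, 0 ≤ r → bar t0 r = 1 := by
    intro r hr
    have hx : 3 ≤ (r + 1) / t0 := by
      rw [le_div_iff₀ ht0]; linarith
    unfold bar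
    rw [phi_of_ge _ (by linarith)]
    apply min_eq_left
    rw [Real.le_log_iff_exp_le (by linarith)]
    linarith [Real.exp_one_lt_d9]
  have h4 : ∀ r, bar t0 r ≤ -1 + 1 / t0 * (1 + r) := by
    intro r
    have := (min_le_right _ _).trans (phi_le ((r + 1) / t0)) (a := bar t0 r)
    have e : 1 / t0 * (1 + r) = (r + 1) / t0 := by field_simp; ring
    rw [e]; linarith
  refine ⟨1 / t0, by positivity, ?_⟩
  have hneg : ∀ r ∈ Ioo (-1 : ℝ) 1, -r ∈ Ioo (-1 : ℝ) 1 := fun r hr =>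
    ⟨by linarith [hr.2], by linarith [hr.1]⟩
  apply exists_mono σ hσ hσp (fun r => - bar t0 (-r)) (bar t0)
    (hc.comp continuous_neg).neg.continuousOn hc.continuousOn
  · intro r hr; linarith [h1 (-r)]
  · intro r hr
    rcases le_total 0 r with h | h
    · rw [h3 r h]; linarith [h2 (-r) (hneg r hr).1]
    · rw [h3 (-r) (by linarith)]; linarith [h2 r hr.1]
  · intro r hr; exact h1 r
  · simp only [neg_neg]
    apply super_reflect
    apply bar_super _ (fun r hr => hσp _ (hneg r hr)) t0 ht0
    intro r hr hr2
    have := hR (-r) (hneg r hr) (by linarith)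
    rw [sub_neg_eq_add, add_comm 1 r] at this
    exact this
  · apply bar_super _ hσp t0 ht0
    intro r hr hr2
    exact hL r hr (by linarith)
  · intro x _ y _ hxy
    have := hm (neg_le_neg hxy)
    simp only; linarith
  · positivity
  · intro r hr
    have := h4 (-r)
    rw [← sub_eq_add_neg] at this
    linarith
  · intro r hr; exact h4 r


/-- the weighted averaging operator -/
noncomputable def J (k : ℕ) (g : ℝ → ℝ) (t : ℝ) : ℝ := ∫ x in (0:ℝ)..1, x ^ k * g (t * x)

lemma mem_scale {R t x : ℝ} (ht : t ∈ Icc (-R) R) (hx : x ∈ Icc (0:ℝ) 1) : t * x ∈ Icc (-R) R := by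
  have hR : 0 ≤ R := by linarith [ht.1, ht.2]
  constructor
  · nlinarith [ht.1, ht.2, hx.1, hx.2, mul_nonneg hR (sub_nonneg.2 hx.2),
      mul_nonneg (sub_nonneg.2 ht.1) hx.1]
  · nlinarith [ht.1, ht.2, hx.1, hx.2, mul_nonneg hR (sub_nonneg.2 hx.2),
      mul_nonneg (sub_nonneg.2 ht.2) hx.1]

lemma exists_R {t : ℝ} (ht : t ∈ Ioo (-2:ℝ) 2) : ∃ R < 2, t ∈ Ioo (-R) R := by
  have : |t| < 2 := abs_lt.2 ht
  refine ⟨(|t| + 2) / 2, by linarith, ?_⟩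
  rw [mem_Ioo, ← abs_lt]; linarith

lemma J_int_cont {g : ℝ → ℝ} (hg : ContinuousOn g (Ioo (-2:ℝ) 2)) (k : ℕ) {t : ℝ}
    (ht : t ∈ Ioo (-2:ℝ) 2) : ContinuousOn (fun x => x ^ k * g (t * x)) (Icc (0:ℝ) 1) := by
  obtain ⟨R, hR, htR⟩ := exists_R ht
  apply (continuous_pow k).continuousOn.mul
  apply hg.comp (continuous_const.mul continuous_id).continuousOn
  intro x hx
  have := mem_scale (Ioo_subset_Icc_self htR) hx
  show t * x ∈ Ioo (-2:ℝ) 2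
  exact ⟨by linarith [this.1], by linarith [this.2]⟩

lemma J_bound {g : ℝ → ℝ} (hg : ContinuousOn g (Ioo (-2:ℝ) 2)) (k : ℕ) {R : ℝ} (hR : R < 2) :
    ∃ C, ∀ t ∈ Icc (-R) R, ∀ x ∈ Icc (0:ℝ) 1, ‖x ^ k * g (t * x)‖ ≤ C := by
  obtain ⟨C, hC⟩ := (isCompact_Icc (a := -R) (b := R)).exists_bound_of_continuousOn
    (hg.mono (fun x hx => ⟨by linarith [hx.1], by linarith [hx.2]⟩))
  refine ⟨C, fun t ht x hx => ?_⟩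
  rw [norm_mul]
  have h1 : ‖x ^ k‖ ≤ 1 := by
    rw [Real.norm_eq_abs, abs_of_nonneg (pow_nonneg hx.1 _)]
    exact pow_le_one₀ hx.1 hx.2
  have h2 := hC _ (mem_scale ht hx)
  calc _ ≤ 1 * C := mul_le_mul h1 h2 (norm_nonneg _) zero_le_one
    _ = C := one_mul _

lemma uIoc01 {x : ℝ} (hx : x ∈ Set.uIoc (0:ℝ) 1) : x ∈ Icc (0:ℝ) 1 := by
  rw [uIoc_of_le zero_le_one] at hx
  exact Ioc_subset_Icc_self hx

lemma J_meas {g : ℝ → ℝ} (hg : ContinuousOn g (Ioo (-2:ℝ) 2)) (k : ℕ) {t : ℝ}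
    (ht : t ∈ Ioo (-2:ℝ) 2) : MeasureTheory.AEStronglyMeasurable (fun x => x ^ k * g (t * x))
      (MeasureTheory.volume.restrict (Set.uIoc (0:ℝ) 1)) :=
  ((J_int_cont hg k ht).mono (fun _ hx => uIoc01 hx)).aestronglyMeasurable measurableSet_uIoc

lemma J_cont {g : ℝ → ℝ} (hg : ContinuousOn g (Ioo (-2:ℝ) 2)) (k : ℕ) :
    ContinuousOn (J k g) (Ioo (-2:ℝ) 2) := by
  intro t ht
  apply ContinuousAt.continuousWithinAt
  obtain ⟨R, hR, htR⟩ := exists_R ht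
  obtain ⟨C, hC⟩ := J_bound hg k hR
  refine intervalIntegral.continuousAt_of_dominated_interval (bound := fun _ => C) ?_ ?_
    intervalIntegrable_const ?_
  · filter_upwards [Ioo_mem_nhds ht.1 ht.2] with s hs using J_meas hg k hs
  · filter_upwards [Ioo_mem_nhds htR.1 htR.2] with s hs
    exact Eventually.of_forall fun x hx => hC s (Ioo_subset_Icc_self hs) x (uIoc01 hx)
  · refine Eventually.of_forall fun x hx => ?_
    have h1 := mem_scale (Ioo_subset_Icc_self htR) (uIoc01 hx)
    have h2 : ContinuousAt g (t * x) :=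
      hg.continuousAt (Ioo_mem_nhds (by linarith [h1.1]) (by linarith [h1.2]))
    exact continuousAt_const.mul
      (ContinuousAt.comp (f := fun s => s * x) h2 (continuous_id.mul continuous_const).continuousAt)

lemma J_deriv {g g' : ℝ → ℝ} (hg : ∀ t ∈ Ioo (-2:ℝ) 2, HasDerivAt g (g' t) t)
    (hg' : ContinuousOn g' (Ioo (-2:ℝ) 2)) (k : ℕ) {t : ℝ} (ht : t ∈ Ioo (-2:ℝ) 2) :
    HasDerivAt (J k g) (J (k+1) g' t) t := by
  have hgc : ContinuousOn g (Ioo (-2:ℝ) 2) := fun t ht => (hg t ht).continuousAt.continuousWithinAt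
  obtain ⟨R, hR, htR⟩ := exists_R ht
  obtain ⟨C, hC⟩ := J_bound hg' (k+1) hR
  refine (intervalIntegral.hasDerivAt_integral_of_dominated_loc_of_deriv_le
    (F := fun t x => x ^ k * g (t * x)) (F' := fun t x => x ^ (k+1) * g' (t * x))
    (bound := fun _ => C) (Ioo_mem_nhds htR.1 htR.2) ?_ ?_ (J_meas hg' (k+1) ht) ?_
    intervalIntegrable_const ?_).2
  · filter_upwards [Ioo_mem_nhds ht.1 ht.2] with s hs using J_meas hgc k hs
  · apply ContinuousOn.intervalIntegrable
    rw [uIcc_of_le zero_le_one]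
    exact J_int_cont hgc k ht
  · exact Eventually.of_forall fun x hx s hs => hC s (Ioo_subset_Icc_self hs) x (uIoc01 hx)
  · refine Eventually.of_forall fun x hx s hs => ?_
    have h1 := mem_scale (Ioo_subset_Icc_self hs) (uIoc01 hx)
    have h2 := hg (s * x) ⟨by linarith [h1.1], by linarith [h1.2]⟩
    have h3 : HasDerivAt (fun s => s * x) x s := by simpa using (hasDerivAt_id s).mul_const x
    have h4 := (h2.comp s h3).const_mul (x ^ k)
    exact h4.congr_deriv (by ring)

lemma J_contDiff (n : ℕ) : ∀ (k : ℕ) {g : ℝ → ℝ}, ContDiffOn ℝ n g (Ioo (-2:ℝ) 2) →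
    ContDiffOn ℝ n (J k g) (Ioo (-2:ℝ) 2) := by
  induction n with
  | zero =>
    intro k g hg
    simp only [Nat.cast_zero, contDiffOn_zero] at hg ⊢
    exact J_cont hg k
  | succ n ih =>
    intro k g hg
    push_cast at hg ⊢
    rw [contDiffOn_succ_iff_deriv_of_isOpen isOpen_Ioo] at hg ⊢
    obtain ⟨h1, -, h2⟩ := hg
    have hd : ∀ t ∈ Ioo (-2:ℝ) 2, HasDerivAt g (deriv g t) t := fun t ht =>
      ((h1 t ht).differentiableAt (Ioo_mem_nhds ht.1 ht.2)).hasDerivAt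
    have hJ := fun t (ht : t ∈ Ioo (-2:ℝ) 2) => J_deriv hd h2.continuousOn k ht
    refine ⟨fun t ht => (hJ t ht).differentiableAt.differentiableWithinAt, by simp, ?_⟩
    exact (ih (k+1) h2).congr fun t ht => (hJ t ht).deriv

lemma J_smooth (k : ℕ) {g : ℝ → ℝ} (hg : ContDiffOn ℝ (⊤ : ℕ∞) g (Ioo (-2:ℝ) 2)) :
    ContDiffOn ℝ (⊤ : ℕ∞) (J k g) (Ioo (-2:ℝ) 2) := by
  rw [contDiffOn_infty] at hg ⊢
  exact fun n => J_contDiff n k (hg n)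

lemma hadamard {f : ℝ → ℝ} (hf : ContDiffOn ℝ (⊤ : ℕ∞) f (Ioo (-2:ℝ) 2)) (h0 : f 0 = 0) :
    ∃ g, ContDiffOn ℝ (⊤ : ℕ∞) g (Ioo (-2:ℝ) 2) ∧ (∀ t ∈ Ioo (-2:ℝ) 2, f t = t * g t) ∧
      g 0 = deriv f 0 := by
  have hf2 := (contDiffOn_infty_iff_deriv_of_isOpen isOpen_Ioo).1 hf
  have hd : ∀ t ∈ Ioo (-2:ℝ) 2, HasDerivAt f (deriv f t) t := fun t ht =>
      ((hf2.1 t ht).differentiableAt (Ioo_mem_nhds ht.1 ht.2)).hasDerivAt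
  refine ⟨J 0 (deriv f), J_smooth 0 hf2.2, ?_, by simp [J]⟩
  intro t ht
  obtain ⟨R, hR, htR⟩ := exists_R ht
  have hmem : ∀ x ∈ Icc (0:ℝ) 1, t * x ∈ Ioo (-2:ℝ) 2 := fun x hx => by
    have := mem_scale (Ioo_subset_Icc_self htR) hx
    exact ⟨by linarith [this.1], by linarith [this.2]⟩
  have := intervalIntegral.integral_eq_sub_of_hasDerivAt (a := 0) (b := 1)
    (f := fun x => f (t * x)) (f' := fun x => t * deriv f (t * x)) ?_ ?_
  · simp only [intervalIntegral.integral_const_mul, mul_one, mul_zero, h0, sub_zero] at this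
    simp only [J, pow_zero, one_mul]
    exact this.symm
  · intro x hx
    rw [uIcc_of_le zero_le_one] at hx
    have h3 : HasDerivAt (fun x => t * x) t x := by simpa using (hasDerivAt_id x).const_mul t
    have h4 := (hd _ (hmem x hx)).comp x h3
    exact h4.congr_deriv (by ring)
  · apply ContinuousOn.intervalIntegrable
    rw [uIcc_of_le zero_le_one]
    have := J_int_cont hf2.2.continuousOn 0 ht
    simp only [pow_zero, one_mul] at this
    exact continuousOn_const.mul this


lemma nonpos_of_deriv {f f' : ℝ → ℝ} {δ : ℝ} (hf : ∀ t ∈ Ioo 0 δ, HasDerivAt f (f' t) t)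
    (h' : ∀ t ∈ Ioo 0 δ, f' t ≤ 0) (h0 : Tendsto f (𝓝[>] 0) (𝓝 0)) :
    ∀ t ∈ Ioo 0 δ, f t ≤ 0 := by
  have hanti : AntitoneOn f (Ioo 0 δ) := by
    apply antitoneOn_of_deriv_nonpos (convex_Ioo 0 δ)
    · exact fun t ht => (hf t ht).continuousAt.continuousWithinAt
    · rw [interior_Ioo]; exact fun t ht => (hf t ht).differentiableAt.differentiableWithinAt
    · rw [interior_Ioo]; intro t ht; rw [(hf t ht).deriv]; exact h' t ht
  intro t ht
  apply ge_of_tendsto h0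
  filter_upwards [Ioo_mem_nhdsGT ht.1] with s hs
  exact hanti ⟨hs.1, hs.2.trans ht.2⟩ ht hs.2.le

lemma eq_of_deriv {f g f' : ℝ → ℝ} {δ : ℝ} (hf : ∀ t ∈ Ioo 0 δ, HasDerivAt f (f' t) t)
    (hg : ∀ t ∈ Ioo 0 δ, HasDerivAt g (f' t) t)
    (h0 : Tendsto (fun t => f t - g t) (𝓝[>] 0) (𝓝 0)) :
    ∀ t ∈ Ioo 0 δ, f t = g t := by
  intro t ht
  have h1 := nonpos_of_deriv (fun t ht => (hf t ht).sub (hg t ht)) (fun t _ => (sub_self _).le)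
    h0 t ht
  have h2 := nonpos_of_deriv (f := fun t => g t - f t) (fun t ht => (hg t ht).sub (hf t ht))
    (fun t _ => (sub_self _).le) (by simpa using h0.neg) t ht
  simp only [Pi.sub_apply] at h1
  linarith

lemma cmp {w w1 w2 : ℝ → ℝ} {δ : ℝ} (h1 : ∀ t ∈ Ioc 0 δ, HasDerivAt w (w1 t) t)
    (h2 : ∀ t ∈ Ioo 0 δ, HasDerivAt w1 (w2 t) t) (h0 : Tendsto w (𝓝[>] 0) (𝓝 0))
    (hδ : w δ ≤ 0) (hp : ∀ t ∈ Ioo 0 δ, 0 < w t → 0 < w2 t) : ∀ t ∈ Ioo 0 δ, w t ≤ 0 := by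
  intro t1 ht1
  by_contra! hc
  have h3 : ∀ᶠ s in 𝓝[>] (0:ℝ), w s < w t1 := h0.eventually (gt_mem_nhds hc)
  obtain ⟨t0, ht0, ht0'⟩ := (h3.and (Ioo_mem_nhdsGT ht1.1)).exists
  have hcont : ContinuousOn w (Icc t0 δ) := fun t ht =>
    (h1 t ⟨ht0'.1.trans_le ht.1, ht.2⟩).continuousAt.continuousWithinAt
  obtain ⟨m, hm, hmax⟩ := isCompact_Icc.exists_isMaxOn
    (nonempty_Icc.2 (ht0'.2.trans ht1.2).le) hcont
  have hm1 : w t1 ≤ w m := hmax ⟨ht0'.2.le, ht1.2.le⟩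
  have hma : t0 < m := lt_of_le_of_ne hm.1 (by rintro rfl; linarith)
  have hmb : m < δ := lt_of_le_of_ne hm.2 (by rintro rfl; linarith)
  have hm0 : 0 < m := ht0'.1.trans hma
  have hloc : IsLocalMax w m := hmax.isLocalMax (Icc_mem_nhds hma hmb)
  have := locmax w w1 (w2 m) m (by
    filter_upwards [Ioo_mem_nhds hm0 hmb] with s hs using h1 s ⟨hs.1, hs.2.le⟩)
    (h2 m ⟨hm0, hmb⟩) hloc
  linarith [hp m ⟨hm0, hmb⟩ (hc.trans_le hm1), this.2]

lemma hasDerivAt_zero_ext {f g : ℝ → ℝ}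
    (f_diff : ∀ t ∈ Ioo (-2:ℝ) 2, t ≠ 0 → HasDerivAt f (g t) t) (hf : ContinuousAt f 0)
    (hg : ContinuousAt g 0) : HasDerivAt f (g 0) 0 := by
  have A : HasDerivWithinAt f (g 0) (Ici 0) 0 := by
    apply hasDerivWithinAt_Ici_of_tendsto_deriv (s := Ioo 0 2) _ hf.continuousWithinAt
      (Ioo_mem_nhdsGT (by norm_num))
    · have : Tendsto g (𝓝[>] 0) (𝓝 (g 0)) := tendsto_inf_left hg
      apply this.congr' _
      filter_upwards [Ioo_mem_nhdsGT (show (0:ℝ) < 2 by norm_num)] with t ht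
      exact (f_diff t ⟨by linarith [ht.1], ht.2⟩ ht.1.ne').deriv.symm
    · exact fun t ht => (f_diff t ⟨by linarith [ht.1], ht.2⟩
        ht.1.ne').differentiableAt.differentiableWithinAt
  have B : HasDerivWithinAt f (g 0) (Iic 0) 0 := by
    apply hasDerivWithinAt_Iic_of_tendsto_deriv (s := Ioo (-2) 0) _ hf.continuousWithinAt
      (Ioo_mem_nhdsLT (by norm_num))
    · have : Tendsto g (𝓝[<] 0) (𝓝 (g 0)) := tendsto_inf_left hg
      apply this.congr' _
      filter_upwards [Ioo_mem_nhdsLT (show (-2:ℝ) < 0 by norm_num)] with t ht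
      exact (f_diff t ⟨ht.1, by linarith [ht.2]⟩ ht.2.ne).deriv.symm
    · exact fun t ht => (f_diff t ⟨ht.1, by linarith [ht.2]⟩
        ht.2.ne).differentiableAt.differentiableWithinAt
  simpa using B.union A

/-- regularity of the coefficient -/
lemma coeff {z : ℝ → ℝ} (hz : ContDiffOn ℝ (⊤ : ℕ∞) z (Ioo (-2:ℝ) 2))
    (hodd : ∀ t ∈ Ioo (-2:ℝ) 2, z (-t) = - z t) (hpos : ∀ t ∈ Ioo (0:ℝ) 2, 0 < z t)
    (hd : deriv z 0 = 1) :
    ∃ B, ContDiffOn ℝ (⊤ : ℕ∞) B (Ioo (-2:ℝ) 2) ∧ (∀ t ∈ Ioo (-2:ℝ) 2, B (-t) = B t) ∧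
      ∀ t ∈ Ioo (0:ℝ) 2, t ^ 2 / z t ^ 2 = 1 + t ^ 2 * B t := by
  have hneg : ∀ t ∈ Ioo (-2:ℝ) 2, -t ∈ Ioo (-2:ℝ) 2 := fun t ht =>
    ⟨by linarith [ht.2], by linarith [ht.1]⟩
  have h0m : (0:ℝ) ∈ Ioo (-2:ℝ) 2 := by constructor <;> norm_num
  have hz0 : z 0 = 0 := by
    have := hodd 0 h0m
    rw [neg_zero] at this; linarith
  obtain ⟨Y, hY, hzY, hY0⟩ := hadamard hz hz0
  rw [hd] at hY0
  have hYev : ∀ t ∈ Ioo (-2:ℝ) 2, Y (-t) = Y t := by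
    intro t ht
    rcases eq_or_ne t 0 with rfl | h
    · simp
    have h1 := hodd t ht
    rw [hzY _ ht, hzY _ (hneg t ht)] at h1
    have : t * (Y (-t) - Y t) = 0 := by linarith
    rcases mul_eq_zero.1 this with h2 | h2
    · exact absurd h2 h
    · linarith
  have hYp : ∀ t ∈ Ioo (0:ℝ) 2, 0 < Y t := by
    intro t ht
    have := hpos t ht
    rw [hzY t ⟨by linarith [ht.1], ht.2⟩] at this
    exact (pos_iff_pos_of_mul_pos this).1 ht.1
  have hYne : ∀ t ∈ Ioo (-2:ℝ) 2, Y t ≠ 0 := by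
    intro t ht
    rcases lt_trichotomy t 0 with h | rfl | h
    · rw [← hYev t ht]
      exact (hYp (-t) ⟨by linarith, by linarith [ht.1]⟩).ne'
    · rw [hY0]; norm_num
    · exact (hYp t ⟨h, ht.2⟩).ne'
  set f : ℝ → ℝ := fun t => (Y t ^ 2)⁻¹ - 1 with hf
  have hfs : ContDiffOn ℝ (⊤ : ℕ∞) f (Ioo (-2:ℝ) 2) :=
    ((hY.pow 2).inv (fun t ht => pow_ne_zero 2 (hYne t ht))).sub contDiffOn_const
  have hfev : ∀ t ∈ Ioo (-2:ℝ) 2, f (-t) = f t := fun t ht => by simp only [hf, hYev t ht]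
  obtain ⟨A, hA, hfA, hA0⟩ := hadamard hfs (by simp [hf, hY0])
  have hdf : deriv f 0 = 0 := by
    have h1 : (fun t => f (-t)) =ᶠ[𝓝 0] f := by
      filter_upwards [Ioo_mem_nhds h0m.1 h0m.2] with t ht using hfev t ht
    have h2 := h1.deriv_eq
    rw [deriv_comp_neg, neg_zero] at h2
    linarith
  rw [hdf] at hA0
  obtain ⟨B, hB, hAB, -⟩ := hadamard hA hA0
  have hfB : ∀ t ∈ Ioo (-2:ℝ) 2, f t = t ^ 2 * B t := fun t ht => by
    rw [hfA t ht, hAB t ht]; ring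
  refine ⟨B, hB, ?_, ?_⟩
  · intro t ht
    rcases eq_or_ne t 0 with rfl | h
    · simp
    have h1 := hfev t ht
    rw [hfB t ht, hfB _ (hneg t ht), neg_sq] at h1
    exact mul_left_cancel₀ (pow_ne_zero 2 h) h1
  · intro t ht
    have ht' : t ∈ Ioo (-2:ℝ) 2 := ⟨by linarith [ht.1], ht.2⟩
    rw [← hfB t ht', hzY t ht', hf]
    have := hYne t ht'
    have := ht.1.ne'
    field_simp
    ring


/-- the local form of the equation near the left end -/
def LocSol (B u u1 : ℝ → ℝ) : Prop := ∀ t ∈ Ioo (0:ℝ) 2,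
  HasDerivAt u (u1 t) t ∧
    HasDerivAt u1 ((1 + t ^ 2 * B t) * (u t * (1 - u t) * (2 - u t)) / t ^ 2) t

lemma q_bound {B u k C t : ℝ} (hC : |B| ≤ C) (hu : 0 < u) (hu1 : u ≤ 1)
    (huk : u ≤ k * t) (ht : 0 < t) (ht1 : t ≤ 1) :
    |(1 + t ^ 2 * B) * ((1 - u) * (2 - u)) - 2| ≤ (3 * k + 2 * C + 1) * t := by
  obtain ⟨h1, h2⟩ := abs_le.1 hC
  have hC0 : 0 ≤ C := (abs_nonneg _).trans hC
  have e : (1 + t ^ 2 * B) * ((1 - u) * (2 - u)) - 2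
      = (u ^ 2 - 3 * u) + (t * ((1 - u) * (2 - u))) * (t * B) := by ring
  have hp0 : 0 ≤ (1 - u) * (2 - u) := mul_nonneg (by linarith) (by linarith)
  have hp2 : (1 - u) * (2 - u) ≤ 2 := by nlinarith
  have hs0 : 0 ≤ t * ((1 - u) * (2 - u)) := by positivity
  have hs2 : t * ((1 - u) * (2 - u)) ≤ 2 := by nlinarith
  have hB : |t * B| ≤ t * C := by
    rw [abs_mul, abs_of_pos ht]; exact mul_le_mul_of_nonneg_left hC ht.le
  have h3 : |(t * ((1 - u) * (2 - u))) * (t * B)| ≤ 2 * (t * C) := by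
    rw [abs_mul, abs_of_nonneg hs0]
    exact mul_le_mul hs2 hB (abs_nonneg _) (by norm_num)
  have h4 : |u ^ 2 - 3 * u| ≤ 3 * (k * t) := by
    rw [abs_le]; constructor <;> nlinarith
  rw [e]
  refine (abs_add_le _ _).trans ?_
  nlinarith

lemma W_bounds {B u u1 : ℝ → ℝ} {k C : ℝ} (hk : 0 < k)
    (hC : ∀ t ∈ Icc (0:ℝ) 1, |B t| ≤ C) (hs : LocSol B u u1)
    (hu0 : ∀ t ∈ Ioo (0:ℝ) 2, 0 < u t) (huk : ∀ t ∈ Ioo (0:ℝ) 2, u t ≤ k * t) :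
    ∃ δ > 0, δ < 1 ∧ ∃ ε > 0, ∃ K, ∀ t ∈ Ioo 0 δ,
      ε * t ^ 2 ≤ u t ∧ u t ≤ K * t ^ 2 ∧ u t < 1 := by
  have hC0 : 0 ≤ C := (abs_nonneg _).trans (hC 0 ⟨le_rfl, zero_le_one⟩)
  set M : ℝ := 3 * k + 2 * C + 1 with hM
  have hM1 : 1 ≤ M := by linarith
  have hM0 : 0 < M := by linarith
  set δ : ℝ := 1 / (2 * M) with hδ
  have hδ0 : 0 < δ := by positivity
  have hMδ : M * δ = 1 / 2 := by rw [hδ]; field_simp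
  have hδ1 : δ ≤ 1 / 2 := by nlinarith
  have hmem : ∀ t ∈ Ioc 0 δ, t ∈ Ioo (0:ℝ) 2 := fun t ht => ⟨ht.1, by linarith [ht.2]⟩
  have hMt : ∀ t ∈ Ioc 0 δ, 0 < M * t ∧ M * t ≤ 1 / 2 := fun t ht =>
    ⟨mul_pos hM0 ht.1, by rw [← hMδ]; exact mul_le_mul_of_nonneg_left ht.2 hM0.le⟩
  have hult : ∀ t ∈ Ioc 0 δ, u t ≤ 1 / 2 := fun t ht => by
    have h1 := huk t (hmem t ht)
    have h2 := (hMt t ht).2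
    have : k * t ≤ M * t := mul_le_mul_of_nonneg_right (by linarith) ht.1.le
    linarith
  have hq : ∀ t ∈ Ioc 0 δ,
      |(1 + t ^ 2 * B t) * ((1 - u t) * (2 - u t)) - 2| ≤ M * t := fun t ht =>
    q_bound (hC t ⟨ht.1.le, by linarith [ht.2]⟩) (hu0 t (hmem t ht))
      (by linarith [hult t ht]) (huk t (hmem t ht)) ht.1 (by linarith [ht.2])
  have hulim : Tendsto u (𝓝[>] 0) (𝓝 0) := by
    have h2 : Tendsto (fun t : ℝ => k * t) (𝓝[>] 0) (𝓝 0) := by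
      have : Continuous fun t : ℝ => k * t := by fun_prop
      simpa using (this.tendsto 0).mono_left nhdsWithin_le_nhds
    refine tendsto_of_tendsto_of_tendsto_of_le_of_le' tendsto_const_nhds h2 ?_ ?_
    · filter_upwards [Ioo_mem_nhdsGT (show (0:ℝ) < 2 by norm_num)] with t ht using (hu0 t ht).le
    · filter_upwards [Ioo_mem_nhdsGT (show (0:ℝ) < 2 by norm_num)] with t ht using huk t ht
  have hpoly : ∀ a b : ℝ, ∀ t : ℝ,
      HasDerivAt (fun t : ℝ => a * (t ^ 2 + b * t ^ 3)) (a * (2 * t + b * (3 * t ^ 2))) t := by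
    intro a b t
    have h1 := ((hasDerivAt_pow 2 t).add ((hasDerivAt_pow 3 t).const_mul b)).const_mul a
    refine h1.congr_deriv ?_
    norm_num
  have hpoly1 : ∀ a b : ℝ, ∀ t : ℝ,
      HasDerivAt (fun t : ℝ => a * (2 * t + b * (3 * t ^ 2))) (a * (2 + b * (6 * t))) t := by
    intro a b t
    have h1 := (((hasDerivAt_id t).const_mul 2).add
      (((hasDerivAt_pow 2 t).const_mul 3).const_mul b)).const_mul a
    refine h1.congr_deriv ?_
    norm_num
    exact Or.inl (Or.inl (by ring))
  have hplim : ∀ a b : ℝ, Tendsto (fun t : ℝ => a * (t ^ 2 + b * t ^ 3)) (𝓝[>] 0) (𝓝 0) := by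
    intro a b
    have : Continuous fun t : ℝ => a * (t ^ 2 + b * t ^ 3) := by fun_prop
    simpa using (this.tendsto 0).mono_left nhdsWithin_le_nhds
  have hδm : δ ∈ Ioc 0 δ := ⟨hδ0, le_rfl⟩
  have hrew : ∀ t ∈ Ioc 0 δ, (1 + t ^ 2 * B t) * (u t * (1 - u t) * (2 - u t)) / t ^ 2
      = ((1 + t ^ 2 * B t) * ((1 - u t) * (2 - u t))) * (u t / t ^ 2) := fun t ht => by ring
  -- upper barrier
  have hup := cmp (w := fun t => u t - 2 / δ ^ 2 * (t ^ 2 + (-M) * t ^ 3)) (δ := δ)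
    (fun t ht => (hs t (hmem t ht)).1.sub (hpoly (2 / δ ^ 2) (-M) t))
    (fun t ht => (hs t (hmem t (Ioo_subset_Ioc_self ht))).2.sub (hpoly1 (2 / δ ^ 2) (-M) t))
    (by simpa using hulim.sub (hplim (2 / δ ^ 2) (-M)))
    (by
      have h1 := hult δ hδm
      have h2 : 2 / δ ^ 2 * (δ ^ 2 + (-M) * δ ^ 3) = 2 * (1 - M * δ) := by
        field_simp
        ring
      simp only [h2, hMδ]; linarith)
    (by
      intro t ht hw
      have ht' := Ioo_subset_Ioc_self ht
      rw [hrew t ht']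
      set q := (1 + t ^ 2 * B t) * ((1 - u t) * (2 - u t))
      have hK : 0 < 2 / δ ^ 2 := by positivity
      set K := 2 / δ ^ 2
      have hqb := (abs_le.1 (hq t ht')).1
      obtain ⟨m0, m1⟩ := hMt t ht'
      have ht2 : 0 < t ^ 2 := pow_pos ht.1 2
      have h1 : K * (1 - M * t) < u t / t ^ 2 := by
        rw [lt_div_iff₀ ht2]; nlinarith
      have h2 : (2 - M * t) * (K * (1 - M * t)) ≤ q * (u t / t ^ 2) := by
        apply mul_le_mul (by linarith) h1.le
        · exact mul_nonneg hK.le (by linarith)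
        · linarith
      have h3 : 0 < K * (3 * (M * t) + (M * t) ^ 2) := by positivity
      nlinarith)
  have hε : 0 < u δ / 2 := half_pos (hu0 δ (hmem δ hδm))
  have hlo := cmp (w := fun t => u δ / 2 * (t ^ 2 + M * t ^ 3) - u t) (δ := δ)
    (fun t ht => (hpoly (u δ / 2) M t).sub (hs t (hmem t ht)).1)
    (fun t ht => (hpoly1 (u δ / 2) M t).sub (hs t (hmem t (Ioo_subset_Ioc_self ht))).2)
    (by simpa using (hplim (u δ / 2) M).sub hulim)
    (by
      have h2 : δ ^ 2 + M * δ ^ 3 = δ ^ 2 * (1 + M * δ) := by ring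
      simp only [h2, hMδ]
      have : δ ^ 2 * (1 + 1 / 2) ≤ 2 := by nlinarith
      nlinarith)
    (by
      intro t ht hw
      have ht' := Ioo_subset_Ioc_self ht
      rw [hrew t ht']
      set q := (1 + t ^ 2 * B t) * ((1 - u t) * (2 - u t))
      set ε := u δ / 2
      have hqb := (abs_le.1 (hq t ht')).2
      obtain ⟨m0, m1⟩ := hMt t ht'
      have ht2 : 0 < t ^ 2 := pow_pos ht.1 2
      have h1 : u t / t ^ 2 < ε * (1 + M * t) := by
        rw [div_lt_iff₀ ht2]; nlinarith
      have h2 : q * (u t / t ^ 2) ≤ (2 + M * t) * (ε * (1 + M * t)) := by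
        apply mul_le_mul (by linarith) h1.le
        · exact div_nonneg (hu0 t (hmem t ht')).le ht2.le
        · linarith
      have h3 : 0 < ε * (M * t) := by positivity
      have h4 : ε * (M * t) * (M * t) ≤ ε * (M * t) * (1 / 2) :=
        mul_le_mul_of_nonneg_left m1 h3.le
      nlinarith)
  refine ⟨δ, hδ0, by linarith, u δ / 2, hε, 2 / δ ^ 2, fun t ht => ?_⟩
  have h1 := hup t ht
  have h2 := hlo t ht
  have h3 := hult t (Ioo_subset_Ioc_self ht)
  have h4 : 0 < t ^ 3 := pow_pos ht.1 3
  have h5 : 0 < 2 / δ ^ 2 * (M * t ^ 3) := by positivity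
  have h6 : 0 < u δ / 2 * (M * t ^ 3) := by positivity
  refine ⟨by nlinarith, by nlinarith, by linarith⟩


def FF (B : ℝ → ℝ) (t w : ℝ) : ℝ :=
  2 * w * B t + (1 + t ^ 2 * B t) * (-3 * w ^ 2 + t ^ 2 * w ^ 3)

lemma P_deriv {B u u1 : ℝ → ℝ} (hs : LocSol B u u1) {t : ℝ} (ht : t ∈ Ioo (0:ℝ) 2) :
    HasDerivAt (fun t => t ^ 2 * u1 t - 2 * t * u t) (t ^ 4 * FF B t (u t / t ^ 2)) t := by
  obtain ⟨h1, h2⟩ := hs t ht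
  have h3 := (((hasDerivAt_pow 2 t).mul h2).sub (((hasDerivAt_id t).const_mul 2).mul h1))
  refine h3.congr_deriv ?_
  have := ht.1.ne'
  simp only [FF, id]
  field_simp
  ring

lemma W_deriv {B u u1 : ℝ → ℝ} (hs : LocSol B u u1) {t : ℝ} (ht : t ∈ Ioo (0:ℝ) 2) :
    HasDerivAt (fun t => u t / t ^ 2) ((t ^ 2 * u1 t - 2 * t * u t) / t ^ 4) t := by
  obtain ⟨h1, -⟩ := hs t ht
  have := ht.1.ne'
  have h3 := h1.div (hasDerivAt_pow 2 t) (pow_ne_zero 2 this)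
  refine h3.congr_deriv ?_
  field_simp
  norm_num
  ring

lemma W_lim {B u u1 : ℝ → ℝ} {k C : ℝ} (hk : 0 < k)
    (hC : ∀ t ∈ Icc (0:ℝ) 1, |B t| ≤ C) (hs : LocSol B u u1)
    (hρ : ∀ t ∈ Ioo (0:ℝ) 2, 0 < 1 + t ^ 2 * B t)
    (hu0 : ∀ t ∈ Ioo (0:ℝ) 2, 0 < u t) (huk : ∀ t ∈ Ioo (0:ℝ) 2, u t ≤ k * t)
    (hu1 : ∀ t ∈ Ioo (0:ℝ) 2, 0 < u1 t) :
    Tendsto (fun t => t ^ 2 * u1 t - 2 * t * u t) (𝓝[>] 0) (𝓝 0) ∧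
    ∃ W0 > 0, Tendsto (fun t => u t / t ^ 2) (𝓝[>] 0) (𝓝 W0) := by
  have hC0 : 0 ≤ C := (abs_nonneg _).trans (hC 0 ⟨le_rfl, zero_le_one⟩)
  obtain ⟨δ, hδ0, hδ1, ε, hε, K, hb⟩ := W_bounds hk hC hs hu0 huk
  have hmem : ∀ t ∈ Ioo 0 δ, t ∈ Ioo (0:ℝ) 2 := fun t ht => ⟨ht.1, by linarith [ht.2]⟩
  have hmono : MonotoneOn u1 (Ioo 0 δ) := by
    apply monotoneOn_of_deriv_nonneg (convex_Ioo 0 δ)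
    · exact fun t ht => (hs t (hmem t ht)).2.continuousAt.continuousWithinAt
    · rw [interior_Ioo]
      exact fun t ht => (hs t (hmem t ht)).2.differentiableAt.differentiableWithinAt
    · rw [interior_Ioo]; intro t ht; rw [(hs t (hmem t ht)).2.deriv]
      have h1 := hρ t (hmem t ht)
      have h2 := hu0 t (hmem t ht)
      have h3 := (hb t ht).2.2
      have h4 : 0 < 1 - u t := by linarith
      have h5 : 0 < 2 - u t := by linarith
      positivity
  have hP0 : Tendsto (fun t => t ^ 2 * u1 t - 2 * t * u t) (𝓝[>] 0) (𝓝 0) := by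
    have h2 : Tendsto (fun t : ℝ => (u1 (δ/2) + 2 * k) * t ^ 2) (𝓝[>] 0) (𝓝 0) := by
      have : Continuous fun t : ℝ => (u1 (δ/2) + 2 * k) * t ^ 2 := by fun_prop
      simpa using (this.tendsto 0).mono_left nhdsWithin_le_nhds
    refine squeeze_zero_norm' ?_ h2
    filter_upwards [Ioo_mem_nhdsGT (half_pos hδ0)] with t ht
    have ht' : t ∈ Ioo 0 δ := ⟨ht.1, by linarith [ht.2]⟩
    have h3 := hmono ht' ⟨by linarith, by linarith⟩ ht.2.le
    have h4 := hu1 t (hmem t ht')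
    have h5 := hu0 t (hmem t ht')
    have h6 := huk t (hmem t ht')
    have h7 : 0 < t ^ 2 := pow_pos ht.1 2
    have h8 : t ^ 2 * u1 t ≤ t ^ 2 * u1 (δ/2) := mul_le_mul_of_nonneg_left h3 h7.le
    have h9 : t * u t ≤ t * (k * t) := mul_le_mul_of_nonneg_left h6 ht.1.le
    have h10 : 0 < t * u t := mul_pos ht.1 h5
    have h11 : 0 < t ^ 2 * u1 t := mul_pos h7 h4
    have h12 : 0 < k * t ^ 2 := mul_pos hk h7
    rw [Real.norm_eq_abs, abs_le]
    constructor <;> nlinarith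
  refine ⟨hP0, ?_⟩
  have hw : ∀ t ∈ Ioo 0 δ, ε ≤ u t / t ^ 2 ∧ u t / t ^ 2 ≤ K := fun t ht => by
    have h7 : 0 < t ^ 2 := pow_pos ht.1 2
    rw [le_div_iff₀ h7, div_le_iff₀ h7]
    exact ⟨(hb t ht).1, (hb t ht).2.1⟩
  have hK : 0 ≤ K := by
    have := hw (δ/2) ⟨by linarith, by linarith⟩
    linarith
  set C2 : ℝ := 2 * K * C + (1 + C) * (3 * K ^ 2 + K ^ 3) with hC2
  have hC20 : 0 ≤ C2 := by positivity
  have hF : ∀ t ∈ Ioo 0 δ, |FF B t (u t / t ^ 2)| ≤ C2 := by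
    intro t ht
    obtain ⟨h1, h2⟩ := hw t ht
    have hBt := hC t ⟨ht.1.le, by linarith [ht.2]⟩
    set w := u t / t ^ 2
    have hw0 : |w| ≤ K := by rw [abs_le]; constructor <;> linarith
    have ht2 : |t ^ 2| ≤ 1 := by
      rw [abs_of_nonneg (sq_nonneg t)]; nlinarith [ht.1, ht.2]
    have e1 : |2 * w * B t| ≤ 2 * K * C := by
      rw [abs_mul, abs_mul, abs_two]; gcongr
    have e2 : |1 + t ^ 2 * B t| ≤ 1 + C := by
      refine (abs_add_le _ _).trans ?_
      rw [abs_one, abs_mul]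
      have : |t ^ 2| * |B t| ≤ 1 * C := by gcongr
      linarith
    have e3 : |-3 * w ^ 2 + t ^ 2 * w ^ 3| ≤ 3 * K ^ 2 + K ^ 3 := by
      refine (abs_add_le _ _).trans ?_
      rw [abs_mul, abs_mul, abs_pow w, abs_pow w]
      have a1 : |(-3:ℝ)| * |w| ^ 2 ≤ 3 * K ^ 2 := by
        rw [abs_neg, abs_of_pos (by norm_num : (0:ℝ) < 3)]; gcongr
      have a2 : |t ^ 2| * |w| ^ 3 ≤ 1 * K ^ 3 := by gcongr
      linarith
    unfold FF
    refine (abs_add_le _ _).trans ?_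
    rw [abs_mul (1 + t ^ 2 * B t)]
    have : |1 + t ^ 2 * B t| * |-3 * w ^ 2 + t ^ 2 * w ^ 3| ≤ (1 + C) * (3 * K ^ 2 + K ^ 3) := by
      gcongr
    linarith
  have hq5 : ∀ t : ℝ, HasDerivAt (fun t : ℝ => C2 / 5 * t ^ 5) (C2 * t ^ 4) t := by
    intro t
    refine ((hasDerivAt_pow 5 t).const_mul (C2/5)).congr_deriv ?_
    norm_num; ring
  have hq0 : Tendsto (fun t : ℝ => C2 / 5 * t ^ 5) (𝓝[>] 0) (𝓝 0) := by
    have : Continuous fun t : ℝ => C2 / 5 * t ^ 5 := by fun_prop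
    simpa using (this.tendsto 0).mono_left nhdsWithin_le_nhds
  have hPle : ∀ t ∈ Ioo 0 δ, |t ^ 2 * u1 t - 2 * t * u t| ≤ C2 / 5 * t ^ 5 := by
    intro t ht
    have hA := nonpos_of_deriv (δ := δ)
      (fun t ht => (P_deriv hs (hmem t ht)).sub (hq5 t)) (fun t ht => by
        have := (abs_le.1 (hF t ht)).2
        have h4 : 0 < t ^ 4 := pow_pos ht.1 4
        nlinarith) (by have := hP0.sub hq0; rw [sub_zero] at this; exact this) t ht
    have hB := nonpos_of_deriv (δ := δ)
      (fun t ht => (P_deriv hs (hmem t ht)).neg.sub (hq5 t)) (fun t ht => by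
        have := (abs_le.1 (hF t ht)).1
        have h4 : 0 < t ^ 4 := pow_pos ht.1 4
        nlinarith) (by
        have := hP0.neg.sub hq0; rw [neg_zero, sub_zero] at this; exact this) t ht
    simp only [Pi.sub_apply, Pi.neg_apply] at hA hB
    rw [abs_le]; constructor <;> linarith
  have hlip : LipschitzOnWith (Real.toNNReal C2) (fun t => u t / t ^ 2) (Ioo 0 δ) := by
    apply (convex_Ioo 0 δ).lipschitzOnWith_of_nnnorm_hasDerivWithin_le
      (fun t ht => (W_deriv hs (hmem t ht)).hasDerivWithinAt)
    intro t ht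
    rw [← NNReal.coe_le_coe, Real.coe_toNNReal _ hC20, coe_nnnorm, Real.norm_eq_abs, abs_div]
    have h4 : 0 < t ^ 4 := pow_pos ht.1 4
    rw [abs_of_pos h4, div_le_iff₀ h4]
    refine (hPle t ht).trans ?_
    have : t ^ 5 ≤ t ^ 4 := by
      have : t ≤ 1 := by linarith [ht.2]
      nlinarith
    nlinarith
  obtain ⟨g, hg, hgeq⟩ := hlip.extend_real
  have hgt : Tendsto (fun t => u t / t ^ 2) (𝓝[>] 0) (𝓝 (g 0)) := by
    refine ((hg.continuous.tendsto 0).mono_left nhdsWithin_le_nhds).congr' ?_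
    filter_upwards [Ioo_mem_nhdsGT hδ0] with t ht using (hgeq ht).symm
  refine ⟨g 0, ?_, hgt⟩
  refine hε.trans_le (ge_of_tendsto hgt ?_)
  filter_upwards [Ioo_mem_nhdsGT hδ0] with t ht using (hw t ht).1


lemma endpoint {B u u1 : ℝ → ℝ} {k : ℝ} (hk : 0 < k)
    (hBs : ContDiffOn ℝ (⊤ : ℕ∞) B (Ioo (-2:ℝ) 2))
    (hBev : ∀ t ∈ Ioo (-2:ℝ) 2, B (-t) = B t) (hs : LocSol B u u1)
    (hρ : ∀ t ∈ Ioo (0:ℝ) 2, 0 < 1 + t ^ 2 * B t)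
    (hu0 : ∀ t ∈ Ioo (0:ℝ) 2, 0 < u t) (huk : ∀ t ∈ Ioo (0:ℝ) 2, u t ≤ k * t)
    (hu1 : ∀ t ∈ Ioo (0:ℝ) 2, 0 < u1 t) :
    ∃ W, ContDiffOn ℝ (⊤ : ℕ∞) W (Ioo (-2:ℝ) 2) ∧ (∀ t ∈ Ioo (-2:ℝ) 2, W (-t) = W t) ∧
      0 < W 0 ∧ ∀ t ∈ Ioo (0:ℝ) 2, u t = t ^ 2 * W t := by
  obtain ⟨C, hC⟩ := (isCompact_Icc (a := (0:ℝ)) (b := 1)).exists_bound_of_continuousOn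
    (hBs.continuousOn.mono (fun x hx => ⟨by linarith [hx.1], by linarith [hx.2]⟩))
  obtain ⟨hP0, W0, hW0, hWlim⟩ := W_lim hk hC hs hρ hu0 huk hu1
  have h0m : (0:ℝ) ∈ Ioo (-2:ℝ) 2 := by constructor <;> norm_num
  set W : ℝ → ℝ := fun t => if t = 0 then W0 else u |t| / t ^ 2 with hW
  have hWz : W 0 = W0 := by simp [hW]
  have hWpos : ∀ t, 0 < t → W t = u t / t ^ 2 := fun t ht => by
    simp only [hW, if_neg ht.ne', abs_of_pos ht]
  have hWev : ∀ t, W (-t) = W t := fun t => by simp [hW]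
  have hWd : ∀ t ∈ Ioo (0:ℝ) 2, HasDerivAt W ((t ^ 2 * u1 t - 2 * t * u t) / t ^ 4) t := by
    intro t ht
    refine (W_deriv hs ht).congr_of_eventuallyEq ?_
    filter_upwards [Ioo_mem_nhds ht.1 ht.2] with s hs using hWpos s hs.1
  have hWc0 : ContinuousAt W 0 := by
    have hR : Tendsto W (𝓝[>] 0) (𝓝 W0) := by
      refine hWlim.congr' ?_
      filter_upwards [self_mem_nhdsWithin] with t ht using (hWpos t ht).symm
    have hL : Tendsto W (𝓝[<] 0) (𝓝 W0) := by
      have hn : Tendsto (fun t : ℝ => -t) (𝓝[<] 0) (𝓝[>] 0) := by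
        simpa using tendsto_neg_nhdsLT (a := (0:ℝ))
      exact (hR.comp hn).congr hWev
    rw [continuousAt_iff_continuous_left'_right']
    simp only [ContinuousWithinAt, hWz]
    exact ⟨hL, hR⟩
  have hWc : ContinuousOn W (Ioo (-2:ℝ) 2) := by
    intro t ht
    apply ContinuousAt.continuousWithinAt
    rcases lt_trichotomy t 0 with h | rfl | h
    · have h1 := (hWd (-t) ⟨by linarith, by linarith [ht.1]⟩).continuousAt
      have h2 : ContinuousAt (fun t => W (-t)) t :=
        ContinuousAt.comp (f := fun t : ℝ => -t) h1 continuous_neg.continuousAt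
      simpa only [hWev] using h2
    · exact hWc0
    · exact (hWd t ⟨h, ht.2⟩).continuousAt
  set G : ℝ → ℝ := fun t => FF B t (W t) with hG
  have hGn : ∀ n : ℕ, ContDiffOn ℝ n W (Ioo (-2:ℝ) 2) → ContDiffOn ℝ n G (Ioo (-2:ℝ) 2) := by
    intro n h
    have hB : ContDiffOn ℝ n B (Ioo (-2:ℝ) 2) := (contDiffOn_infty.1 hBs) n
    have ht : ContDiffOn ℝ n (fun t : ℝ => t ^ 2) (Ioo (-2:ℝ) 2) := (contDiff_id.pow 2).contDiffOn
    exact ((contDiffOn_const.mul h).mul hB).add ((contDiffOn_const.add (ht.mul hB)).mul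
      ((contDiffOn_const.mul (h.pow 2)).add (ht.mul (h.pow 3))))
  have hGc : ContinuousOn G (Ioo (-2:ℝ) 2) := by
    have := hGn 0 (by simpa using hWc)
    simpa using this
  have hGev : ∀ t ∈ Ioo (-2:ℝ) 2, G (-t) = G t := fun t ht => by
    simp only [hG, FF, hBev t ht, hWev, neg_sq]
  have hJev : ∀ t ∈ Ioo (-2:ℝ) 2, J 4 G (-t) = J 4 G t := by
    intro t ht
    obtain ⟨R, hR, htR⟩ := exists_R ht
    apply intervalIntegral.integral_congr
    intro x hx
    rw [uIcc_of_le zero_le_one] at hx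
    have := mem_scale (Ioo_subset_Icc_self htR) hx
    simp only [neg_mul]
    rw [hGev _ ⟨by linarith [this.1], by linarith [this.2]⟩]
  -- identify `P` with the integral
  have hIeq : ∀ t, t ^ 5 * J 4 G t = ∫ s in (0:ℝ)..t, s ^ 4 * G s := by
    intro t
    have := intervalIntegral.mul_integral_comp_mul_left (a := 0) (b := 1)
      (f := fun s => s ^ 4 * G s) t
    simp only [mul_zero, mul_one] at this
    rw [← this, J, ← intervalIntegral.integral_const_mul, ← intervalIntegral.integral_const_mul]
    congr 1
    ext x
    ring
  have hsG : ContinuousOn (fun s => s ^ 4 * G s) (Ioo (-2:ℝ) 2) :=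
    (continuous_pow 4).continuousOn.mul hGc
  have hId : ∀ t ∈ Ioo (0:ℝ) 2, HasDerivAt (fun t => t ^ 5 * J 4 G t)
      (t ^ 4 * FF B t (u t / t ^ 2)) t := by
    intro t ht
    have ht' : t ∈ Ioo (-2:ℝ) 2 := ⟨by linarith [ht.1], ht.2⟩
    have e : (fun t => t ^ 5 * J 4 G t) = fun t => ∫ s in (0:ℝ)..t, s ^ 4 * G s := funext hIeq
    rw [e]
    have := intervalIntegral.integral_hasDerivAt_right (a := 0) (b := t)
      (f := fun s => s ^ 4 * G s) ?_ ?_ (hsG.continuousAt (Ioo_mem_nhds ht'.1 ht'.2))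
    · simpa only [hG, hWpos t ht.1] using this
    · apply (hsG.mono ?_).intervalIntegrable
      rw [uIcc_of_le ht.1.le]
      exact fun s hs => ⟨by linarith [hs.1], by linarith [hs.2, ht.2]⟩
    · exact hsG.stronglyMeasurableAtFilter isOpen_Ioo t ht'
  have hI0 : Tendsto (fun t => t ^ 5 * J 4 G t) (𝓝[>] 0) (𝓝 0) := by
    have h1 : ContinuousAt (fun t => t ^ 5 * J 4 G t) 0 :=
      (continuous_pow 5).continuousAt.mul
        ((J_cont hGc 4).continuousAt (Ioo_mem_nhds h0m.1 h0m.2))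
    have h2 : Tendsto (fun t => t ^ 5 * J 4 G t) (𝓝[>] 0) (𝓝 (0 ^ 5 * J 4 G 0)) :=
      h1.tendsto.mono_left nhdsWithin_le_nhds
    simpa using h2
  have hPI := eq_of_deriv (δ := 2) (fun t ht => P_deriv hs ht) hId (by simpa using hP0.sub hI0)
  have hDc : ContinuousOn (fun t => t * J 4 G t) (Ioo (-2:ℝ) 2) :=
    continuous_id.continuousOn.mul (J_cont hGc 4)
  have hWdp : ∀ t ∈ Ioo (0:ℝ) 2, HasDerivAt W (t * J 4 G t) t := by
    intro t ht
    refine (hWd t ht).congr_deriv ?_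
    rw [hPI t ht]
    have := ht.1.ne'
    field_simp
  have hWdne : ∀ t ∈ Ioo (-2:ℝ) 2, t ≠ 0 → HasDerivAt W (t * J 4 G t) t := by
    intro t ht h
    rcases lt_or_gt_of_ne h with h | h
    · have h1 := hWdp (-t) ⟨by linarith, by linarith [ht.1]⟩
      have h2 := h1.comp t (hasDerivAt_neg t)
      have e : W ∘ Neg.neg = W := funext hWev
      have h3 : HasDerivAt (W ∘ Neg.neg) (-t * J 4 G (-t) * -1) t := h2
      rw [e, hJev t ht] at h3
      exact h3.congr_deriv (by ring)
    · exact hWdp t ⟨h, ht.2⟩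
  have hWdall : ∀ t ∈ Ioo (-2:ℝ) 2, HasDerivAt W (t * J 4 G t) t := by
    intro t ht
    rcases eq_or_ne t 0 with rfl | h
    · exact hasDerivAt_zero_ext hWdne hWc0 (hDc.continuousAt (Ioo_mem_nhds h0m.1 h0m.2))
    · exact hWdne t ht h
  have hboot : ∀ n : ℕ, ContDiffOn ℝ n W (Ioo (-2:ℝ) 2) := by
    intro n
    induction n with
    | zero => simpa using hWc
    | succ n ih =>
      push_cast
      rw [contDiffOn_succ_iff_deriv_of_isOpen isOpen_Ioo]
      refine ⟨fun t ht => (hWdall t ht).differentiableAt.differentiableWithinAt, by simp, ?_⟩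
      exact (contDiffOn_id.mul (J_contDiff n 4 (hGn n ih))).congr fun t ht => (hWdall t ht).deriv
  refine ⟨W, contDiffOn_infty.2 hboot, fun t _ => hWev t, by rw [hWz]; exact hW0, ?_⟩
  intro t ht
  rw [hWpos t ht.1]
  have := ht.1.ne'
  field_simp


lemma coeff_y {y : ℝ → ℝ} (hy : ContDiffOn ℝ (⊤ : ℕ∞) y (Ioo (-3:ℝ) 3))
    (hpos : ∀ r ∈ Ioo (-1:ℝ) 1, 0 < y r)
    (hodd : ∀ t ∈ Ioo (-2:ℝ) 2, y (-1 - t) = - y (-1 + t)) (hd : deriv y (-1) = 1) :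
    ∃ B, ContDiffOn ℝ (⊤ : ℕ∞) B (Ioo (-2:ℝ) 2) ∧ (∀ t ∈ Ioo (-2:ℝ) 2, B (-t) = B t) ∧
      ∀ t ∈ Ioo (0:ℝ) 2, t ^ 2 / y (-1 + t) ^ 2 = 1 + t ^ 2 * B t := by
  apply coeff (z := fun t => y (-1 + t))
  · apply hy.comp (contDiff_const.add contDiff_id).contDiffOn
    intro t ht
    show -1 + t ∈ Ioo (-3:ℝ) 3
    exact ⟨by linarith [ht.1], by linarith [ht.2]⟩
  · intro t ht
    have := hodd t ht
    rwa [sub_eq_add_neg] at this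
  · exact fun t ht => hpos _ ⟨by linarith [ht.1], by linarith [ht.2]⟩
  · rw [deriv_comp_const_add]
    simpa using hd

lemma sigma_low {y : ℝ → ℝ} (hy : ContDiffOn ℝ (⊤ : ℕ∞) y (Ioo (-3:ℝ) 3))
    (hpos : ∀ r ∈ Ioo (-1:ℝ) 1, 0 < y r)
    (hodd : ∀ t ∈ Ioo (-2:ℝ) 2, y (-1 - t) = - y (-1 + t)) (hd : deriv y (-1) = 1) :
    ∃ δ > 0, ∀ r ∈ Ioo (-1:ℝ) 1, r + 1 ≤ δ → 4/9 * (r + 1) ^ 2 ≤ y r ^ 2 := by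
  obtain ⟨B, hB, -, hyB⟩ := coeff_y hy hpos hodd hd
  have hc : ContinuousAt (fun t => 1 + t ^ 2 * B t) 0 :=
    continuousAt_const.add ((continuous_pow 2).continuousAt.mul
      (hB.continuousOn.continuousAt (Ioo_mem_nhds (by norm_num) (by norm_num))))
  have h1 : ∀ᶠ t in 𝓝 (0:ℝ), 1 + t ^ 2 * B t < 9/4 :=
    hc.eventually (gt_mem_nhds (by norm_num))
  obtain ⟨δ, hδ, hδ'⟩ := Metric.eventually_nhds_iff.1 h1
  refine ⟨δ / 2, half_pos hδ, fun r hr hrδ => ?_⟩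
  have ht : r + 1 ∈ Ioo (0:ℝ) 2 := ⟨by linarith [hr.1], by linarith [hr.2]⟩
  have h2 := hδ' (y := r + 1) (by
    rw [Real.dist_eq, sub_zero, abs_of_pos ht.1]; linarith)
  rw [← hyB _ ht] at h2
  have e : -1 + (r + 1) = r := by ring
  rw [e] at h2
  have hp : 0 < y r ^ 2 := pow_pos (hpos r hr) 2
  rw [div_lt_iff₀ hp] at h2
  linarith

lemma left_end {y l v : ℝ → ℝ} {k : ℝ} (hk : 0 < k)
    (hy : ContDiffOn ℝ (⊤ : ℕ∞) y (Ioo (-3:ℝ) 3))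
    (hpos : ∀ r ∈ Ioo (-1:ℝ) 1, 0 < y r)
    (hodd : ∀ t ∈ Ioo (-2:ℝ) 2, y (-1 - t) = - y (-1 + t)) (hd : deriv y (-1) = 1)
    (hsol : SolOn (fun r => y r ^ 2) (Ioo (-1) 1) l v)
    (hb : ∀ r ∈ Ioo (-1:ℝ) 1, -1 < l r ∧ 0 < v r ∧ l r ≤ -1 + k * (1 + r)) :
    ∃ W, ContDiffOn ℝ (⊤ : ℕ∞) W (Ioo (-2:ℝ) 2) ∧ (∀ t ∈ Ioo (-2:ℝ) 2, W (-t) = W t) ∧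
      0 < W 0 ∧ ∀ r ∈ Ioo (-1:ℝ) 1, l r = -1 + (r + 1) ^ 2 * W (r + 1) := by
  obtain ⟨B, hB, hBev, hyB⟩ := coeff_y hy hpos hodd hd
  have hm : ∀ t ∈ Ioo (0:ℝ) 2, -1 + t ∈ Ioo (-1:ℝ) 1 := fun t ht =>
    ⟨by linarith [ht.1], by linarith [ht.2]⟩
  have H : ∃ W, ContDiffOn ℝ (⊤ : ℕ∞) W (Ioo (-2:ℝ) 2) ∧ (∀ t ∈ Ioo (-2:ℝ) 2, W (-t) = W t) ∧
      0 < W 0 ∧ ∀ t ∈ Ioo (0:ℝ) 2, l (-1 + t) + 1 = t ^ 2 * W t := by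
    refine endpoint (u := fun t => l (-1 + t) + 1)
      (u1 := fun t => v (-1 + t)) hk hB hBev ?_ ?_ ?_ ?_ ?_
    · intro t ht
      obtain ⟨e1, e2⟩ := hsol _ (hm t ht)
      have hsh : HasDerivAt (fun t : ℝ => -1 + t) 1 t := (hasDerivAt_id t).const_add (-1)
      refine ⟨?_, ?_⟩
      · have := (e1.comp t hsh).add_const 1
        exact this.congr_deriv (mul_one _)
      · have := (e2.comp t hsh)
        refine this.congr_deriv ?_
        rw [← hyB t ht, fz]
        have hy0 := (hpos _ (hm t ht)).ne'
        have ht0 := ht.1.ne'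
        field_simp
        ring
    · intro t ht
      rw [← hyB t ht]
      exact div_pos (pow_pos ht.1 2) (pow_pos (hpos _ (hm t ht)) 2)
    · intro t ht
      have := (hb _ (hm t ht)).1
      show 0 < l (-1 + t) + 1
      linarith
    · intro t ht
      have := (hb _ (hm t ht)).2.2
      show l (-1 + t) + 1 ≤ k * t
      have e : k * (1 + (-1 + t)) = k * t := by ring
      linarith
    · exact fun t ht => (hb _ (hm t ht)).2.1
  obtain ⟨W, h1, h2, h3, h4⟩ := H
  refine ⟨W, h1, h2, h3, fun r hr => ?_⟩
  have := h4 (r + 1) ⟨by linarith [hr.1], by linarith [hr.2]⟩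
  have e : -1 + (r + 1) = r := by ring
  rw [e] at this
  linarith

lemma dd_zero {W : ℝ → ℝ} (hW : ContDiffOn ℝ (⊤ : ℕ∞) W (Ioo (-2:ℝ) 2)) :
    deriv (deriv (fun t => t ^ 2 * W t)) 0 = 2 * W 0 := by
  have h0m : (0:ℝ) ∈ Ioo (-2:ℝ) 2 := by constructor <;> norm_num
  have hW2 := (contDiffOn_infty_iff_deriv_of_isOpen isOpen_Ioo).1 hW
  have hW3 := (contDiffOn_infty_iff_deriv_of_isOpen isOpen_Ioo).1 hW2.2
  have hd : ∀ t ∈ Ioo (-2:ℝ) 2, HasDerivAt W (deriv W t) t := fun t ht =>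
      ((hW2.1 t ht).differentiableAt (Ioo_mem_nhds ht.1 ht.2)).hasDerivAt
  have hd2 : HasDerivAt (deriv W) (deriv (deriv W) 0) 0 :=
      ((hW3.1 0 h0m).differentiableAt (Ioo_mem_nhds h0m.1 h0m.2)).hasDerivAt
  have e1 : deriv (fun t => t ^ 2 * W t) =ᶠ[𝓝 0] fun t => 2 * t * W t + t ^ 2 * deriv W t := by
    filter_upwards [Ioo_mem_nhds h0m.1 h0m.2] with t ht
    have := ((hasDerivAt_pow 2 t).mul (hd t ht)).deriv
    refine Eq.trans this ?_
    norm_num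
  rw [e1.deriv_eq]
  have h5 := (((hasDerivAt_id (0:ℝ)).const_mul 2).mul (hd 0 h0m)).add
    ((hasDerivAt_pow 2 (0:ℝ)).mul hd2)
  refine Eq.trans h5.deriv ?_
  norm_num

theorem main (y : ℝ → ℝ)
    (hy : ContDiffOn ℝ (⊤ : ℕ∞) y (Set.Ioo (-3 : ℝ) 3))
    (hypos : ∀ r ∈ Set.Ioo (-1 : ℝ) 1, 0 < y r)
    (hyoddL : ∀ t ∈ Set.Ioo (-2 : ℝ) 2, y (-1 - t) = - y (-1 + t))
    (hyoddR : ∀ t ∈ Set.Ioo (-2 : ℝ) 2, y (1 + t) = - y (1 - t))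
    (hy'L : deriv y (-1) = 1) (hy'R : deriv y 1 = -1) :
    ∃ l : ℝ → ℝ,
      ContDiffOn ℝ (⊤ : ℕ∞) l (Set.Ioo (-3 : ℝ) 3) ∧
      (∀ t ∈ Set.Ioo (-2 : ℝ) 2, l (-1 - t) = l (-1 + t)) ∧
      (∀ t ∈ Set.Ioo (-2 : ℝ) 2, l (1 + t) = l (1 - t)) ∧
      (∀ r ∈ Set.Ioo (-1 : ℝ) 1, deriv (deriv l) r = (l r ^ 3 - l r) / (y r) ^ 2) ∧
      l (-1) = -1 ∧ l 1 = 1 ∧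
      (∀ r ∈ Set.Ioo (-1 : ℝ) 1, 0 < deriv l r) ∧
      0 < deriv (deriv l) (-1) ∧ deriv (deriv l) 1 < 0 := by
  -- the reflected function
  set z : ℝ → ℝ := fun r => y (-r) with hz
  have hzs : ContDiffOn ℝ (⊤ : ℕ∞) z (Ioo (-3:ℝ) 3) := by
    apply hy.comp contDiff_neg.contDiffOn
    intro t ht
    exact ⟨by linarith [ht.2], by linarith [ht.1]⟩
  have hneg : ∀ r ∈ Ioo (-1:ℝ) 1, -r ∈ Ioo (-1:ℝ) 1 := fun r hr =>
    ⟨by linarith [hr.2], by linarith [hr.1]⟩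
  have hzpos : ∀ r ∈ Ioo (-1:ℝ) 1, 0 < z r := fun r hr => hypos _ (hneg r hr)
  have hzodd : ∀ t ∈ Ioo (-2:ℝ) 2, z (-1 - t) = - z (-1 + t) := by
    intro t ht
    have := hyoddR t ht
    simp only [hz]
    rw [show -(-1 - t) = 1 + t by ring, show -(-1 + t) = 1 - t by ring, this]
  have hzd : deriv z (-1) = 1 := by
    rw [hz, deriv_comp_neg, neg_neg, hy'R, neg_neg]
  obtain ⟨δ1, hδ1, hl1⟩ := sigma_low hy hypos hyoddL hy'L
  obtain ⟨δ2, hδ2, hl2⟩ := sigma_low hzs hzpos hzodd hzd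
  obtain ⟨k, hk, l, v, hsol, hb⟩ := exists_sol (fun r => y r ^ 2)
    ((hy.continuousOn.mono (fun r hr => ⟨by linarith [hr.1], by linarith [hr.2]⟩)).pow 2)
    (fun r hr => pow_pos (hypos r hr) 2) (min δ1 δ2) (lt_min hδ1 hδ2)
    (fun r hr h => hl1 r hr (h.trans (min_le_left _ _)))
    (fun r hr h => by
      have := hl2 (-r) (hneg r hr) (by
        have := h.trans (min_le_right δ1 δ2)
        linarith)
      simp only [hz, neg_neg] at this
      rwa [show -r + 1 = 1 - r by ring] at this)
  obtain ⟨W, hWs, hWev, hW0, hWl⟩ := left_end hk hy hypos hyoddL hy'L hsol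
    (fun r hr => ⟨(hb r hr).1, (hb r hr).2.2.1, (hb r hr).2.2.2.1⟩)
  obtain ⟨V, hVs, hVev, hV0, hVl⟩ := left_end (l := fun r => -l (-r)) (v := fun r => v (-r))
    hk hzs hzpos hzodd hzd
    (by
      intro r hr
      obtain ⟨e1, e2⟩ := hsol _ (hneg r hr)
      have f1 := (e1.comp r (hasDerivAt_neg r)).neg
      have f2 := e2.comp r (hasDerivAt_neg r)
      refine ⟨f1.congr_deriv (by ring), f2.congr_deriv ?_⟩
      simp only [fz, hz]
      ring)
    (fun r hr => by
      obtain ⟨a1, a2, a3, a4, a5⟩ := hb _ (hneg r hr)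
      refine ⟨by linarith, a3, ?_⟩
      have e : k * (1 - -r) = k * (1 + r) := by ring
      linarith)
  have hVl' : ∀ r ∈ Ioo (-1:ℝ) 1, l r = 1 - (1 - r) ^ 2 * V (1 - r) := by
    intro r hr
    have := hVl (-r) (hneg r hr)
    simp only [neg_neg] at this
    rw [show -r + 1 = 1 - r by ring] at this
    linarith
  set M1 : ℝ → ℝ := fun t => t ^ 2 * W t with hM1
  set M2 : ℝ → ℝ := fun t => t ^ 2 * V t with hM2
  have hM1s : ContDiffOn ℝ (⊤ : ℕ∞) M1 (Ioo (-2:ℝ) 2) := (contDiff_id.pow 2).contDiffOn.mul hWs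
  have hM2s : ContDiffOn ℝ (⊤ : ℕ∞) M2 (Ioo (-2:ℝ) 2) := (contDiff_id.pow 2).contDiffOn.mul hVs
  set L1 : ℝ → ℝ := fun r => -1 + M1 (r + 1) with hL1
  set L2 : ℝ → ℝ := fun r => 1 - M2 (1 - r) with hL2
  set L : ℝ → ℝ := fun r => if r < 1 then L1 r else L2 r with hL
  have hLl : ∀ r ∈ Ioo (-1:ℝ) 1, L r = l r := by
    intro r hr
    simp only [hL, if_pos hr.2, hL1, hM1]
    exact (hWl r hr).symm
  have hLL1 : ∀ r, r < 1 → L r = L1 r := fun r hr => by simp only [hL, if_pos hr]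
  have hLL2 : ∀ r, -1 < r → L r = L2 r := by
    intro r hr
    by_cases h : r < 1
    · rw [hLl r ⟨hr, h⟩, hVl' r ⟨hr, h⟩]
    · simp only [hL, if_neg h]
  have ev1 : ∀ r, r < 1 → L =ᶠ[𝓝 r] L1 := fun r hr => by
    filter_upwards [Iio_mem_nhds hr] with s hs using hLL1 s hs
  have ev2 : ∀ r, -1 < r → L =ᶠ[𝓝 r] L2 := fun r hr => by
    filter_upwards [Ioi_mem_nhds hr] with s hs using hLL2 s hs
  have evd : ∀ r ∈ Ioo (-1:ℝ) 1, deriv L r = v r := by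
    intro r hr
    have h1 : L =ᶠ[𝓝 r] l := by
      filter_upwards [Ioo_mem_nhds hr.1 hr.2] with s hs using hLl s hs
    rw [h1.deriv_eq, (hsol r hr).1.deriv]
  have dL1 : deriv (deriv L1) (-1) = 2 * W 0 := by
    have e1 : deriv L1 = fun r => deriv M1 (r + 1) := by
      ext r
      rw [hL1, deriv_const_add, deriv_comp_add_const]
    rw [e1, deriv_comp_add_const, neg_add_cancel, hM1, dd_zero hWs]
  have dL2 : deriv (deriv L2) 1 = -(2 * V 0) := by
    have e1 : deriv L2 = fun r => deriv M2 (1 - r) := by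
      ext r
      rw [hL2, deriv_const_sub, deriv_comp_const_sub, neg_neg]
    rw [e1, deriv_comp_const_sub, sub_self, hM2, dd_zero hVs]
  refine ⟨L, ?_, ?_, ?_, ?_, ?_, ?_, ?_, ?_, ?_⟩
  · intro r hr
    apply ContDiffAt.contDiffWithinAt
    rcases lt_or_ge r 0 with h | h
    · refine ContDiffAt.congr_of_eventuallyEq ?_ (ev1 r (by linarith))
      have h1 : ContDiffAt ℝ (⊤ : ℕ∞) M1 (r + 1) :=
        hM1s.contDiffAt (Ioo_mem_nhds (by linarith [hr.1]) (by linarith))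
      exact contDiffAt_const.add
        (ContDiffAt.comp (f := fun r : ℝ => r + 1) r h1 (contDiff_id.add contDiff_const).contDiffAt)
    · refine ContDiffAt.congr_of_eventuallyEq ?_ (ev2 r (by linarith))
      have h1 : ContDiffAt ℝ (⊤ : ℕ∞) M2 (1 - r) :=
        hM2s.contDiffAt (Ioo_mem_nhds (by linarith [hr.2]) (by linarith))
      exact contDiffAt_const.sub
        (ContDiffAt.comp (f := fun r : ℝ => 1 - r) r h1 (contDiff_const.sub contDiff_id).contDiffAt)
  · intro t ht
    rw [hLL1 _ (by linarith [ht.1]), hLL1 _ (by linarith [ht.2])]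
    simp only [hL1, hM1]
    rw [show -1 - t + 1 = -t by ring, show -1 + t + 1 = t by ring, hWev t ht, neg_sq]
  · intro t ht
    rw [hLL2 _ (by linarith [ht.1]), hLL2 _ (by linarith [ht.2])]
    simp only [hL2, hM2]
    rw [show 1 - (1 + t) = -t by ring, show 1 - (1 - t) = t by ring, hVev t ht, neg_sq]
  · intro r hr
    have h1 : deriv L =ᶠ[𝓝 r] v := by
      filter_upwards [Ioo_mem_nhds hr.1 hr.2] with s hs using evd s hs
    rw [h1.deriv_eq, (hsol r hr).2.deriv, hLl r hr, fz]
  · rw [hLL1 _ (by norm_num)]; simp [hL1, hM1]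
  · rw [hLL2 _ (by norm_num)]; simp [hL2, hM2]
  · intro r hr
    rw [evd r hr]; exact (hb r hr).2.2.1
  · rw [(ev1 (-1) (by norm_num)).deriv.deriv_eq, dL1]; linarith
  · rw [(ev2 1 (by norm_num)).deriv.deriv_eq, dL2]; linarith

end Stmt15

/-- existence for the `SO(3)` boundary-value problem.
`y` is smooth on `(-3,3)`, positive on `(-1,1)`, odd about `r = -1` and about
`r = 1`, with `y'(-1) = 1`, `y'(1) = -1`; `σ = y²`.  There exists `l`, a restriction
of a smooth function on `(-3,3)` even about `-1` and about `1`, solving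
`l'' = (l³ - l)/σ` on `(-1,1)` with `l(-1) = -1`, `l(1) = 1`, `l' > 0` on `(-1,1)`,
`l''(-1) > 0` and `l''(1) < 0`. -/
theorem stmt_15 (y : ℝ → ℝ)
    (hy : ContDiffOn ℝ (⊤ : ℕ∞) y (Set.Ioo (-3 : ℝ) 3))
    (hypos : ∀ r ∈ Set.Ioo (-1 : ℝ) 1, 0 < y r)
    (hyoddL : ∀ t ∈ Set.Ioo (-2 : ℝ) 2, y (-1 - t) = - y (-1 + t))
    (hyoddR : ∀ t ∈ Set.Ioo (-2 : ℝ) 2, y (1 + t) = - y (1 - t))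
    (hy'L : deriv y (-1) = 1) (hy'R : deriv y 1 = -1) :
    ∃ l : ℝ → ℝ,
      ContDiffOn ℝ (⊤ : ℕ∞) l (Set.Ioo (-3 : ℝ) 3) ∧
      (∀ t ∈ Set.Ioo (-2 : ℝ) 2, l (-1 - t) = l (-1 + t)) ∧
      (∀ t ∈ Set.Ioo (-2 : ℝ) 2, l (1 + t) = l (1 - t)) ∧
      (∀ r ∈ Set.Ioo (-1 : ℝ) 1, deriv (deriv l) r = (l r ^ 3 - l r) / (y r) ^ 2) ∧
      l (-1) = -1 ∧ l 1 = 1 ∧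
      (∀ r ∈ Set.Ioo (-1 : ℝ) 1, 0 < deriv l r) ∧
      0 < deriv (deriv l) (-1) ∧ deriv (deriv l) 1 < 0 := by
  exact Stmt15.main y hy hypos hyoddL hyoddR hy'L hy'R
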